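/- arXiv:2010.12528 — 2 statements merged into one kernel-verified Lean document; each statement's English description precedes it below -/
import Mathlib

section
/- Let E be a finite set of edges with positive integer length function l. Among all DP-systems on connected metric graphs assembled from E, there exists one attaining the maximal stabilization time whose underlying graph is a bead graph in which every vertex has degree at most three, and whose initial set consists of a single vertex of degree one (a terminal vertex). -/
/-!
Common framework: metric multigraphs assembled from an edge set `E`
(`ends : E → Sym2 V` with distinct endpoints), walks, dynamic-point
systems, stabilization times, and structural graph notions.
-/

/-- Walks in a multigraph on vertices `V` with edge set `E` and endpoint map `ends`:
an alternating sequence of vertices and edges. -/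
inductive MGWalk {E V : Type} (ends : E → Sym2 V) : V → V → Type where
  | nil (a : V) : MGWalk ends a a
  | cons {a b c : V} (e : E) (h : ends e = s(a, b)) (tail : MGWalk ends b c) :
      MGWalk ends a c

namespace MGWalk

variable {E V : Type} {ends : E → Sym2 V}

/-- Length of a walk with respect to an edge-length function. -/
def length (l : E → ℝ) : ∀ {a b : V}, MGWalk ends a b → ℝ
  | _, _, nil _ => 0
  | _, _, cons e _ tail => l e + tail.length l

/-- The list of edge entries of a walk. -/
def edges : ∀ {a b : V}, MGWalk ends a b → List E
  | _, _, nil _ => []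
  | _, _, cons e _ tail => e :: tail.edges

end MGWalk

/-- A DP-system on a metric graph assembled from `E`: the vertex set is finite,
no edge is a loop, the multigraph is connected, and the set of initial vertices
is nonempty. -/
def IsDPSystem {E V : Type} (ends : E → Sym2 V) (S : Set V) : Prop :=
  Finite V ∧ (∀ e, ¬ (ends e).IsDiag) ∧ (∀ a b : V, Nonempty (MGWalk ends a b)) ∧
    S.Nonempty

/-- A dynamic point is present at time `t` at distance `s` from endpoint `x` of
edge `e` (on the arc leaving `x`) iff some walk from an initial vertex to `x`
has length `t - s`. -/
def IsPoint {E V : Type} (ends : E → Sym2 V) (l : E → ℝ) (S : Set V)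
    (t : ℝ) (e : E) (x : V) (s : ℝ) : Prop :=
  x ∈ ends e ∧ 0 ≤ s ∧ s < l e ∧
    ∃ v₀ ∈ S, ∃ w : MGWalk ends v₀ x, w.length l = t - s

/-- Number of dynamic points on edge `e` at time `t`. -/
noncomputable def NptsEdge {E V : Type} (ends : E → Sym2 V) (l : E → ℝ)
    (S : Set V) (e : E) (t : ℝ) : ℕ :=
  Set.ncard {p : V × ℝ | IsPoint ends l S t e p.1 p.2}

/-- Total number of dynamic points at time `t`. -/
noncomputable def Npts {E V : Type} (ends : E → Sym2 V) (l : E → ℝ)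
    (S : Set V) (t : ℝ) : ℕ :=
  Set.ncard {p : E × V × ℝ | IsPoint ends l S t p.1 p.2.1 p.2.2}

/-- `T` is a stabilization bound: `T ≥ 0` and the total number of points is
constant from `T` on. -/
def IsStabBound {E V : Type} (ends : E → Sym2 V) (l : E → ℝ) (S : Set V)
    (T : ℝ) : Prop :=
  0 ≤ T ∧ ∀ t ≥ T, Npts ends l S t = Npts ends l S T

/-- The stabilization time: the least stabilization bound. -/
noncomputable def stabTime {E V : Type} (ends : E → Sym2 V) (l : E → ℝ)
    (S : Set V) : ℝ :=
  sInf {T : ℝ | IsStabBound ends l S T}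

/-- `T` is a stabilization bound for edge `e`. -/
def IsEdgeStabBound {E V : Type} (ends : E → Sym2 V) (l : E → ℝ) (S : Set V)
    (e : E) (T : ℝ) : Prop :=
  0 ≤ T ∧ ∀ t ≥ T, NptsEdge ends l S e t = NptsEdge ends l S e T

/-- The stabilization time of edge `e`. -/
noncomputable def edgeStabTime {E V : Type} (ends : E → Sym2 V) (l : E → ℝ)
    (S : Set V) (e : E) : ℝ :=
  sInf {T : ℝ | IsEdgeStabBound ends l S e T}

/-- Membership in `LSTDP(E)` (given the underlying system is a DP-system):
its stabilization time is maximal among all DP-systems assembled from `E`. -/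
def IsMaxStab {E : Type} (l : E → ℝ) {V : Type} (ends : E → Sym2 V)
    (S : Set V) : Prop :=
  ∀ (V' : Type) (ends' : E → Sym2 V') (S' : Set V'),
    IsDPSystem ends' S' → stabTime ends' l S' ≤ stabTime ends l S

/-- Degree of vertex `x` in the subgraph with edge set `C`. -/
noncomputable def edgeDegree {E V : Type} (ends : E → Sym2 V) (C : Set E)
    (x : V) : ℕ :=
  Set.ncard {e ∈ C | x ∈ ends e}

/-- Degree of vertex `x` in the whole graph. -/
noncomputable def degree {E V : Type} (ends : E → Sym2 V) (x : V) : ℕ :=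
  Set.ncard {e : E | x ∈ ends e}

/-- `x` is a vertex of the subgraph with edge set `C`. -/
def OnEdgeSet {E V : Type} (ends : E → Sym2 V) (C : Set E) (x : V) : Prop :=
  ∃ e ∈ C, x ∈ ends e

/-- The subgraph with edge set `C` is connected. -/
def EdgeSetConn {E V : Type} (ends : E → Sym2 V) (C : Set E) : Prop :=
  ∀ a b : V, OnEdgeSet ends C a → OnEdgeSet ends C b →
    ∃ w : MGWalk ends a b, ∀ e ∈ w.edges, e ∈ C

/-- `C` is the edge set of a cycle: nonempty, connected, and every vertex of its
support has degree exactly two in it. -/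
def IsCycleSet {E V : Type} (ends : E → Sym2 V) (C : Set E) : Prop :=
  C.Nonempty ∧ EdgeSetConn ends C ∧
    ∀ x : V, OnEdgeSet ends C x → edgeDegree ends C x = 2

/-- A bead graph: no vertex lies on two distinct cycles. -/
def IsBead {E V : Type} (ends : E → Sym2 V) : Prop :=
  ∀ C₁ C₂ : Set E, IsCycleSet ends C₁ → IsCycleSet ends C₂ → C₁ ≠ C₂ →
    ∀ x : V, ¬ (OnEdgeSet ends C₁ x ∧ OnEdgeSet ends C₂ x)

/-- The graph has no cycles. -/
def IsAcyclicG {E V : Type} (ends : E → Sym2 V) : Prop :=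
  ∀ C : Set E, ¬ IsCycleSet ends C

/-- `H` is the edge set of a path subgraph: nonempty, connected, acyclic, and
all degrees within `H` are at most two. -/
def IsPathSet {E V : Type} (ends : E → Sym2 V) (H : Set E) : Prop :=
  H.Nonempty ∧ EdgeSetConn ends H ∧ (∀ C ⊆ H, ¬ IsCycleSet ends C) ∧
    ∀ x : V, edgeDegree ends H x ≤ 2

/-- `x` is a terminal vertex of the path subgraph `H`. -/
def IsHandleTerminal {E V : Type} (ends : E → Sym2 V) (H : Set E) (x : V) : Prop :=
  edgeDegree ends H x = 1

/-- The type `W(v, e)` of walks from `v` to an endpoint of edge `e`. -/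
def WalkTo {E V : Type} (ends : E → Sym2 V) (v : V) (e : E) : Type :=
  { p : Σ x : V, MGWalk ends v x // p.1 ∈ ends e }

/-- The relation `≈` on `W(v, e)`: walks with the same final endpoint are related
iff their lengths are congruent modulo `2·l(e)`; walks with different final
endpoints are related iff the difference of their lengths is congruent to
`l(e)` modulo `2·l(e)`. -/
def wapprox {E V : Type} (ends : E → Sym2 V) (l : E → ℝ) (v : V) (e : E)
    (w₁ w₂ : WalkTo ends v e) : Prop :=
  (w₁.1.1 = w₂.1.1 ∧
    ∃ k : ℤ, w₁.1.2.length l - w₂.1.2.length l = k * (2 * l e)) ∨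
  (w₁.1.1 ≠ w₂.1.1 ∧
    ∃ k : ℤ, w₁.1.2.length l - w₂.1.2.length l - l e = k * (2 * l e))

section

open scoped Classical

namespace MGWalk

variable {E V : Type} {ends : E → Sym2 V}

/-- Concatenation of walks. -/
def append : ∀ {a b c : V}, MGWalk ends a b → MGWalk ends b c → MGWalk ends a c
  | _, _, _, nil _, q => q
  | _, _, _, cons e h t, q => cons e h (t.append q)

@[simp]
theorem edges_nil (a : V) : (nil a : MGWalk ends a a).edges = [] := rfl

@[simp]
theorem edges_cons {a b c : V} (e : E) (h : ends e = s(a, b)) (t : MGWalk ends b c) :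
    (cons e h t).edges = e :: t.edges := rfl

@[simp]
theorem edges_append {a b c : V} (p : MGWalk ends a b) (q : MGWalk ends b c) :
    (p.append q).edges = p.edges ++ q.edges := by
  induction p with
  | nil a => rfl
  | cons e h t ih => simp [append, ih]

theorem exists_reverse {a b : V} (p : MGWalk ends a b) :
    ∃ q : MGWalk ends b a, q.edges = p.edges.reverse := by
  induction p with
  | nil a => exact ⟨nil a, rfl⟩
  | @cons a b c e h t ih =>
    obtain ⟨q, hq⟩ := ih
    exact ⟨q.append (cons e (h.trans Sym2.eq_swap) (nil a)), by simp [hq]⟩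

/-- Length of a walk for natural edge lengths. -/
def natLength (l : E → ℕ) {a b : V} (w : MGWalk ends a b) : ℕ := (w.edges.map l).sum

theorem length_eq_natLength (l : E → ℕ) {a b : V} (w : MGWalk ends a b) :
    w.length (fun e => (l e : ℝ)) = (w.natLength l : ℝ) := by
  induction w with
  | nil a => simp [length, natLength]
  | cons e h t ih => simp [length, ih, natLength]

@[simp]
theorem natLength_append (l : E → ℕ) {a b c : V} (p : MGWalk ends a b) (q : MGWalk ends b c) :
    (p.append q).natLength l = p.natLength l + q.natLength l := by
  simp [natLength]

theorem natLength_eq_sum [Fintype E] (l : E → ℕ) {a b : V} (w : MGWalk ends a b) :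
    w.natLength l = ∑ f, w.edges.count f * l f := by
  induction w with
  | nil a => simp [natLength]
  | cons e h t ih =>
    simp only [natLength, edges_cons, List.map_cons, List.sum_cons, List.count_cons, add_mul,
      Finset.sum_add_distrib] at ih ⊢
    rw [ih]
    simp [add_comm]

/-- A walk can be split at every vertex it visits. -/
theorem exists_split {a b : V} (w : MGWalk ends a b) {f : E} (hf : f ∈ w.edges) {z : V}
    (hz : z ∈ ends f) :
    ∃ (p : MGWalk ends a z) (q : MGWalk ends z b), w.edges = p.edges ++ q.edges := by
  induction w with
  | nil a => simp at hf
  | @cons a b c e h t ih =>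
    rw [edges_cons, List.mem_cons] at hf
    by_cases hfe : f = e
    · subst hfe
      rw [h, Sym2.mem_iff] at hz
      rcases hz with rfl | rfl
      · exact ⟨nil _, cons f h t, rfl⟩
      · exact ⟨cons f h (nil _), t, rfl⟩
    · obtain ⟨p, q, hpq⟩ := ih (hf.resolve_left hfe)
      exact ⟨cons e h p, q, by simp [hpq]⟩

theorem exists_initial_walk {a b : V} (w : MGWalk ends a b) {L₁ L₂ : List E} {f : E}
    (hw : w.edges = L₁ ++ f :: L₂) :
    ∃ z ∈ ends f, ∃ q : MGWalk ends a z, q.edges = L₁ := by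
  induction w generalizing L₁ with
  | nil a => simp at hw
  | @cons a b c e h t ih =>
    cases L₁ with
    | nil =>
      simp only [edges_cons, List.nil_append, List.cons.injEq] at hw
      refine ⟨a, ?_, nil a, rfl⟩
      rw [← hw.1, h]; simp
    | cons g L₁ =>
      simp only [edges_cons, List.cons_append, List.cons.injEq] at hw
      obtain ⟨z, hz, q, hq⟩ := ih hw.2
      exact ⟨z, hz, cons e h q, by simp [hq, hw.1]⟩

/-- An edge still to be taken, at a vertex visited by the walk. -/
theorem exists_residual_edge {a b : V} (w : MGWalk ends a b) (n : E → ℕ) {f : E}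
    (hf : w.edges.count f < n f) {x y : V} (q : MGWalk ends x y) (hy : y ∈ ends f)
    (hq : ∀ g ∈ q.edges, 0 < n g)
    (hx : ∃ (p : MGWalk ends a x) (r : MGWalk ends x b), w.edges = p.edges ++ r.edges) :
    ∃ (z : V) (g : E), z ∈ ends g ∧ w.edges.count g < n g ∧
      ∃ (p : MGWalk ends a z) (r : MGWalk ends z b), w.edges = p.edges ++ r.edges := by
  induction q with
  | nil x => exact ⟨x, f, hy, hf, hx⟩
  | @cons x u y e h t ih =>
    by_cases he : e ∈ w.edges
    · exact ih hy (fun g hg => hq g (by simp [hg])) (w.exists_split he (by simp [h]))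
    · refine ⟨x, e, by simp [h], ?_, hx⟩
      rw [List.count_eq_zero_of_not_mem he]
      exact hq e (by simp)

end MGWalk

open MGWalk

variable {E V : Type} [Fintype E]

/-- Indicator of equality, modulo two. -/
noncomputable def eqInd (z a : V) : ZMod 2 := if z = a then 1 else 0

/-- Parity of the degree of `z` when the edge `f` is taken `n f` times. -/
noncomputable def degParity (ends : E → Sym2 V) (n : E → ℕ) (z : V) : ZMod 2 :=
  ∑ f, if z ∈ ends f then (n f : ZMod 2) else 0

variable {ends : E → Sym2 V}

theorem degParity_add (n m : E → ℕ) (z : V) :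
    degParity ends (fun f => n f + m f) z = degParity ends n z + degParity ends m z := by
  simp only [degParity, ← Finset.sum_add_distrib]
  refine Finset.sum_congr rfl fun f _ => ?_
  split_ifs <;> simp

theorem degParity_congr {n m : E → ℕ} (h : ∀ f, (n f : ZMod 2) = m f) (z : V) :
    degParity ends n z = degParity ends m z := by
  simp [degParity, h]

theorem degParity_single (hd : ∀ e, ¬ (ends e).IsDiag) {e : E} {a b : V} (h : ends e = s(a, b))
    (z : V) :
    degParity ends (fun f => if f = e then 1 else 0) z = eqInd z a + eqInd z b := by
  have hab : a ≠ b := by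
    have := hd e
    rwa [h, Sym2.mk_isDiag_iff] at this
  have : degParity ends (fun f => if f = e then 1 else 0) z = if z ∈ ends e then 1 else 0 := by
    rw [degParity, Finset.sum_eq_single e]
    · simp
    · intro f _ hf; simp [hf]
    · simp
  rw [this, h]
  by_cases h1 : z = a <;> by_cases h2 : z = b <;> simp_all [eqInd]

theorem zmod_two_add_self (x : ZMod 2) : x + x = 0 := CharTwo.add_self_eq_zero x

theorem degParity_count (hd : ∀ e, ¬ (ends e).IsDiag) {a b : V} (w : MGWalk ends a b) (z : V) :
    degParity ends (fun f => w.edges.count f) z = eqInd z a + eqInd z b := by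
  induction w with
  | nil a => simp [degParity, CharTwo.add_self_eq_zero]
  | @cons a b c e h t ih =>
    have : (fun f => (cons e h t).edges.count f) =
        fun f => t.edges.count f + (if f = e then 1 else 0) := by
      funext f
      simp only [edges_cons, List.count_cons, beq_iff_eq, eq_comm (a := e)]
    rw [this, degParity_add, ih, degParity_single hd h]
    linear_combination zmod_two_add_self (eqInd z b)

theorem exists_walk_count_le (hd : ∀ e, ¬ (ends e).IsDiag) {a b : V} (n : E → ℕ)
    (hn : ∀ z, degParity ends n z = eqInd z a + eqInd z b) :
    ∃ w : MGWalk ends a b, ∀ f, w.edges.count f ≤ n f := by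
  induction hk : ∑ f, n f generalizing n a with
  | zero =>
    by_cases hab : a = b
    · subst hab
      exact ⟨nil a, by simp⟩
    · have := hn a
      have h0 : ∀ f, n f = 0 := by simpa using hk
      simp [degParity, h0, eqInd, hab] at this
  | succ k ih =>
    by_cases hab : a = b
    · subst hab
      exact ⟨nil a, by simp⟩
    · have h1 : degParity ends n a ≠ 0 := by
        rw [hn a]; simp [eqInd, hab]
      obtain ⟨f, -, hf⟩ := Finset.exists_ne_zero_of_sum_ne_zero h1
      have haf : a ∈ ends f := by
        by_contra h; simp [h] at hf
      have hnf : n f ≠ 0 := by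
        intro h; simp [h] at hf
      obtain ⟨c, hc⟩ := haf
      set m : E → ℕ := fun g => n g - if g = f then 1 else 0 with hm
      have hnm : n = fun g => m g + if g = f then 1 else 0 := by
        funext g
        by_cases hg : g = f
        · subst hg; simp [hm]; omega
        · simp [hm, hg]
      obtain ⟨w, hw⟩ := ih (a := c) m (by
        intro z
        have := hn z
        rw [hnm, degParity_add, degParity_single hd hc] at this
        linear_combination this - zmod_two_add_self (eqInd z c)) (by
        rw [hnm, Finset.sum_add_distrib] at hk
        simpa using hk)
      refine ⟨cons f hc w, fun g => ?_⟩
      have := hw g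
      rw [hnm]
      simp only [edges_cons, List.count_cons, beq_iff_eq, eq_comm (a := f)]
      omega

/-- Euler's theorem: prescribed multiplicities with the right parities and connected support
are those of a walk. -/
theorem exists_walk_count_eq (hd : ∀ e, ¬ (ends e).IsDiag) {a b : V} (n : E → ℕ)
    (hn : ∀ z, degParity ends n z = eqInd z a + eqInd z b)
    (hc : ∀ f, 0 < n f → ∃ z ∈ ends f, ∃ q : MGWalk ends a z, ∀ g ∈ q.edges, 0 < n g) :
    ∃ w : MGWalk ends a b, ∀ f, w.edges.count f = n f := by
  have key : ∀ (k : ℕ) (w : MGWalk ends a b), (∀ f, w.edges.count f ≤ n f) →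
      ∑ f, (n f - w.edges.count f) = k →
      ∃ w : MGWalk ends a b, ∀ f, w.edges.count f = n f := by
    intro k
    induction k using Nat.strong_induction_on with
    | _ k ih =>
      intro w hw hk
      by_cases hall : ∀ f, w.edges.count f = n f
      · exact ⟨w, hall⟩
      push Not at hall
      obtain ⟨f, hf⟩ := hall
      have hf' : w.edges.count f < n f := lt_of_le_of_ne (hw f) hf
      obtain ⟨y, hy, q, hq⟩ := hc f (by omega)
      obtain ⟨z, g, hz, hg, p, r, hpr⟩ :=
        exists_residual_edge w n hf' q hy hq ⟨nil a, w, rfl⟩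
      obtain ⟨c, hzc⟩ := hz
      set m : E → ℕ := fun h => n h - w.edges.count h - if h = g then 1 else 0 with hm
      have hnm : n = fun h => (m h + w.edges.count h) + if h = g then 1 else 0 := by
        funext h
        have := hw h
        by_cases hh : h = g
        · subst hh; simp [hm]; omega
        · simp [hm, hh]; omega
      obtain ⟨s, hs⟩ := exists_walk_count_le hd (a := c) (b := z) m (by
        intro u
        have := hn u
        rw [hnm, degParity_add, degParity_add, degParity_count hd, degParity_single hd hzc] at this
        linear_combination this - zmod_two_add_self (eqInd u c) - zmod_two_add_self (eqInd u z))
      have hcount : ∀ h, ((p.append (cons g hzc s)).append r).edges.count h =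
          w.edges.count h + s.edges.count h + if h = g then 1 else 0 := by
        intro h
        simp only [edges_append, edges_cons, hpr, List.count_append, List.count_cons, beq_iff_eq,
          eq_comm (a := g)]
        omega
      have hle : ∀ h, ((p.append (cons g hzc s)).append r).edges.count h ≤ n h := by
        intro h
        have h1 := hs h
        have h2 := congrFun hnm h
        rw [hcount]
        omega
      refine ih _ ?_ _ hle rfl
      rw [← hk]
      refine Finset.sum_lt_sum (fun h _ => ?_) ⟨g, Finset.mem_univ _, ?_⟩
      · rw [hcount]; omega
      · rw [hcount]; simp; omega
  obtain ⟨w, hw⟩ := exists_walk_count_le hd n hn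
  exact key _ w hw rfl

end

section

open scoped Classical

open MGWalk

variable {E V : Type} {ends : E → Sym2 V}

/-- Arrivals at the ends `z`, `z'` of an edge of length `L`, after walks of lengths `k`, `k'`,
which produce the same perpetual point on that edge. -/
def SameArrival {V : Type} (L : ℕ) (z : V) (k : ℕ) (z' : V) (k' : ℕ) : Prop :=
  (z = z' ∧ k ≡ k' [MOD 2 * L]) ∨ (z ≠ z' ∧ k + L ≡ k' [MOD 2 * L])

/-- The phase, modulo twice the edge length, of an arrival at `z` after length `k`. -/
noncomputable def phase (ends : E → Sym2 V) (l : E → ℕ) (e : E) (z : V) (k : ℕ) : ℕ :=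
  (k + if z = (ends e).out.1 then 0 else l e) % (2 * l e)

theorem phase_eq_iff (l : E → ℕ) {e : E} {z z' : V} (hz : z ∈ ends e) (hz' : z' ∈ ends e)
    (k k' : ℕ) :
    phase ends l e z k = phase ends l e z' k' ↔ SameArrival (l e) z k z' k' := by
  have hout : ends e = s((ends e).out.1, (ends e).out.2) := by
    rw [Sym2.mk, Prod.mk.eta]; exact (Quot.out_eq _).symm
  have hL : ∀ a b : ℕ, a + l e ≡ b [MOD 2 * l e] ↔ a ≡ b + l e [MOD 2 * l e] := by
    intro a b
    constructor <;> intro h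
    · have h2 := h.add_right (l e)
      have h3 : a + l e + l e = a + 2 * l e := by ring
      rw [h3] at h2
      exact (Nat.ModEq.symm (by simp [Nat.ModEq])).trans h2
    · have h2 := h.add_right (l e)
      have h3 : b + l e + l e = b + 2 * l e := by ring
      rw [h3] at h2
      exact h2.trans (by simp [Nat.ModEq])
  rw [hout, Sym2.mem_iff] at hz hz'
  unfold phase SameArrival
  change _ ≡ _ [MOD _] ↔ _
  by_cases h1 : z = (ends e).out.1 <;> by_cases h2 : z' = (ends e).out.1
  · simp [h1, h2]
  · have : z ≠ z' := fun h => h2 (h ▸ h1)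
    simp only [h1, h2, if_true, if_false, add_zero]
    rw [h1] at this
    simp [this, hL]
  · simp [h1, h2]
  · have : z = z' := by
      rw [hz.resolve_left h1, hz'.resolve_left h2]
    subst this
    simp only [h1, if_false, true_and, ne_eq, not_true, false_and, or_false]
    exact ⟨fun h => Nat.ModEq.add_right_cancel' _ h, fun h => h.add_right _⟩

theorem exists_cross (l : E → ℕ) {e : E} {v z : V} (hz : z ∈ ends e) (w : MGWalk ends v z)
    (hd : ∀ e, ¬ (ends e).IsDiag) (k : ℕ) :
    ∃ z' ∈ ends e, ∃ w' : MGWalk ends v z', w'.natLength l = w.natLength l + k * l e ∧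
      phase ends l e z' (w'.natLength l) = phase ends l e z (w.natLength l) := by
  induction k with
  | zero => exact ⟨z, hz, w, by simp, rfl⟩
  | succ k ih =>
    obtain ⟨z', hz', w', h1, h2⟩ := ih
    obtain ⟨u, hu⟩ := hz'
    have hne : z' ≠ u := by
      have := hd e
      rwa [hu, Sym2.mk_isDiag_iff] at this
    have hlen : (w'.append (cons e hu (nil u))).natLength l = w'.natLength l + l e := by
      rw [natLength_append]; simp [natLength]
    refine ⟨u, by simp [hu], w'.append (cons e hu (nil u)), ?_, ?_⟩
    · rw [hlen, h1]; ring
    · rw [← h2, eq_comm, phase_eq_iff l (by simp [hu]) (by simp [hu]), hlen]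
      exact Or.inr ⟨hne, rfl⟩

/-- The perpetual points, as edges with a phase, that are born by time `t`. -/
def born (ends : E → Sym2 V) (l : E → ℕ) (S : Set V) (t : ℝ) : Set (E × ℕ) :=
  {q | ∃ v ∈ S, ∃ z ∈ ends q.1, ∃ w : MGWalk ends v z,
    phase ends l q.1 z (w.natLength l) = q.2 ∧ (w.natLength l : ℝ) ≤ t}

theorem born_mono (l : E → ℕ) (S : Set V) {t t' : ℝ} (h : t ≤ t') :
    born ends l S t ⊆ born ends l S t' := by
  rintro q ⟨v, hv, z, hz, w, h1, h2⟩
  exact ⟨v, hv, z, hz, w, h1, h2.trans h⟩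

theorem finite_phases [Fintype E] (l : E → ℕ) : {q : E × ℕ | q.2 < 2 * l q.1}.Finite := by
  refine (Set.finite_univ.prod (Set.finite_Iio (2 * ∑ f, l f))).subset ?_
  rintro ⟨e, k⟩ hq
  have : l e ≤ ∑ f, l f := Finset.single_le_sum (fun _ _ => Nat.zero_le _) (Finset.mem_univ e)
  simp only [Set.mem_ofPred_eq] at hq
  simp only [Set.mem_prod, Set.mem_univ, Set.mem_Iio, true_and]
  omega

theorem born_subset (l : E → ℕ) (hl : ∀ e, 0 < l e) (S : Set V) (t : ℝ) :
    born ends l S t ⊆ {q : E × ℕ | q.2 < 2 * l q.1} := by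
  rintro q ⟨v, hv, z, hz, w, h1, h2⟩
  simp only [Set.mem_ofPred_eq, ← h1]
  exact Nat.mod_lt _ (by have := hl q.1; omega)

theorem Npts_eq_ncard_born (l : E → ℕ) (hl : ∀ e, 0 < l e) (hd : ∀ e, ¬ (ends e).IsDiag)
    (S : Set V) (t : ℝ) :
    Npts ends (fun e => (l e : ℝ)) S t = (born ends l S t).ncard := by
  unfold Npts
  refine Set.ncard_congr (fun p _ => (p.1, phase ends l p.1 p.2.1 ⌊t - p.2.2⌋₊)) ?_ ?_ ?_
  · rintro ⟨e, x, s⟩ ⟨hx, hs0, hs, v, hv, w, hw⟩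
    rw [length_eq_natLength] at hw
    refine ⟨v, hv, x, hx, w, ?_, ?_⟩
    · simp only at hw ⊢
      rw [← hw, Nat.floor_natCast]
    · simp only at hw hs0 ⊢
      linarith
  · rintro ⟨e, x, s⟩ ⟨e', x', s'⟩ ⟨hx, hs0, hs, v, hv, w, hw⟩ ⟨hx', hs0', hs', v', hv', w', hw'⟩ h
    rw [length_eq_natLength] at hw hw'
    simp only [Prod.mk.injEq] at hx hs0 hs hw hx' hs0' hs' hw' h ⊢
    obtain ⟨rfl, h⟩ := h
    rw [← hw, ← hw', Nat.floor_natCast, Nat.floor_natCast, phase_eq_iff l hx hx'] at h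
    set k := w.natLength l
    set k' := w'.natLength l
    have h1 : (k : ℝ) < k' + l e := by linarith
    have h2 : (k' : ℝ) < k + l e := by linarith
    norm_cast at h1 h2
    rcases h with ⟨rfl, h⟩ | ⟨hne, h⟩
    · have : k = k' := by
        rcases le_total k k' with hle | hle
        · have := (Nat.modEq_iff_dvd' hle).1 h
          have := Nat.eq_zero_of_dvd_of_lt this (by omega)
          omega
        · have := (Nat.modEq_iff_dvd' hle).1 h.symm
          have := Nat.eq_zero_of_dvd_of_lt this (by omega)
          omega
      refine ⟨rfl, rfl, ?_⟩
      have : (k : ℝ) = k' := by exact_mod_cast this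
      linarith
    · exfalso
      have := (Nat.modEq_iff_dvd' (by omega)).1 h.symm
      have := Nat.eq_zero_of_dvd_of_lt this (by omega)
      omega
  · rintro ⟨e, θ⟩ ⟨v, hv, z, hz, w, h1, h2⟩
    simp only at hz h1
    have hle : (0 : ℝ) < l e := by exact_mod_cast hl e
    obtain ⟨z', hz', w', h3, h4⟩ := exists_cross l hz w hd ⌊(t - w.natLength l) / l e⌋₊
    have h5 := Nat.floor_le (a := (t - w.natLength l) / l e)
      (div_nonneg (by linarith) hle.le)
    have h6 := Nat.lt_floor_add_one ((t - w.natLength l) / l e)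
    rw [le_div_iff₀ hle] at h5
    rw [div_lt_iff₀ hle] at h6
    have h7 : (w'.natLength l : ℝ) =
        w.natLength l + ⌊(t - w.natLength l) / l e⌋₊ * l e := by exact_mod_cast h3
    refine ⟨(e, z', t - w'.natLength l), ⟨hz', ?_, ?_, v, hv, w', ?_⟩, ?_⟩
    · simp only; linarith
    · simp only; linarith
    · rw [length_eq_natLength]; simp
    · simp [h4, h1]

theorem isStabBound_iff [Fintype E] (l : E → ℕ) (hl : ∀ e, 0 < l e) (hd : ∀ e, ¬ (ends e).IsDiag)
    (S : Set V) (T : ℝ) :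
    IsStabBound ends (fun e => (l e : ℝ)) S T ↔
      0 ≤ T ∧ ∀ t, born ends l S t ⊆ born ends l S T := by
  unfold IsStabBound
  refine and_congr_right fun _ => ?_
  simp only [Npts_eq_ncard_born l hl hd]
  constructor
  · intro h t
    rcases le_total t T with ht | ht
    · exact born_mono l S ht
    · rw [← Set.eq_of_subset_of_ncard_le (born_mono l S ht) (h t ht).le
        ((finite_phases l).subset (born_subset l hl S t))]
  · intro h t ht
    rw [(h t).antisymm (born_mono l S ht)]

theorem exists_walk_stabTime [Fintype E] [Nonempty E] (l : E → ℕ) (hl : ∀ e, 0 < l e) {S : Set V}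
    (hG : IsDPSystem ends S) :
    ∃ v ∈ S, ∃ (e : E), ∃ z ∈ ends e, ∃ w : MGWalk ends v z,
      IsStabBound ends (fun e => (l e : ℝ)) S (w.natLength l) ∧
      ∀ v' ∈ S, ∀ z' ∈ ends e, ∀ w' : MGWalk ends v' z',
        SameArrival (l e) z (w.natLength l) z' (w'.natLength l) →
        w.natLength l ≤ w'.natLength l := by
  obtain ⟨-, hd, hconn, v₀, hv₀⟩ := hG
  set Q : Set (E × ℕ) := ⋃ t, born ends l S t with hQ
  have hQf : Q.Finite := (finite_phases l).subset (Set.iUnion_subset (born_subset l hl S))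
  have hQn : Q.Nonempty := by
    obtain ⟨e⟩ := ‹Nonempty E›
    obtain ⟨z, hz⟩ : ∃ z, z ∈ ends e := ⟨_, Sym2.out_fst_mem _⟩
    obtain ⟨w⟩ := hconn v₀ z
    exact ⟨(e, phase ends l e z (w.natLength l)),
      Set.mem_iUnion.2 ⟨w.natLength l, v₀, hv₀, z, hz, w, rfl, le_rfl⟩⟩
  set A : E × ℕ → Set ℕ := fun q => {k | ∃ v ∈ S, ∃ z ∈ ends q.1, ∃ w : MGWalk ends v z,
    phase ends l q.1 z (w.natLength l) = q.2 ∧ w.natLength l = k} with hA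
  obtain ⟨q, hq, hmax⟩ := Set.exists_max_image Q (fun q => sInf (A q)) hQf hQn
  have hAn : ∀ q ∈ Q, (A q).Nonempty := by
    intro q hq
    obtain ⟨t, v, hv, z, hz, w, h1, h2⟩ := Set.mem_iUnion.1 hq
    exact ⟨_, v, hv, z, hz, w, h1, rfl⟩
  obtain ⟨v, hv, z, hz, w, h1, h2⟩ := Nat.sInf_mem (hAn q hq)
  refine ⟨v, hv, q.1, z, hz, w, ?_, ?_⟩
  · rw [isStabBound_iff l hl hd]
    refine ⟨by positivity, fun t q' hq' => ?_⟩
    have hq'' : q' ∈ Q := Set.mem_iUnion.2 ⟨t, hq'⟩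
    obtain ⟨v', hv', z', hz', w', h1', h2'⟩ := Nat.sInf_mem (hAn q' hq'')
    refine ⟨v', hv', z', hz', w', h1', ?_⟩
    rw [h2', h2]
    exact_mod_cast hmax q' hq''
  · intro v' hv' z' hz' w' hsame
    rw [h2]
    refine Nat.sInf_le ⟨v', hv', z', hz', w', ?_, rfl⟩
    rw [← h1, eq_comm, phase_eq_iff l hz hz']
    exact hsame

theorem le_stabTime [Fintype E] [Nonempty E] (l : E → ℕ) (hl : ∀ e, 0 < l e) {S : Set V}
    (hG : IsDPSystem ends S) (m : ℕ) {v z : V} (hv : v ∈ S) {e : E} (hz : z ∈ ends e)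
    (w : MGWalk ends v z)
    (hm : ∀ v' ∈ S, ∀ z' ∈ ends e, ∀ w' : MGWalk ends v' z',
      SameArrival (l e) z (w.natLength l) z' (w'.natLength l) → m ≤ w'.natLength l) :
    (m : ℝ) ≤ stabTime ends (fun e => (l e : ℝ)) S := by
  obtain ⟨_, _, _, _, _, w₁, h, -⟩ := exists_walk_stabTime l hl hG
  refine le_csInf ⟨_, h⟩ fun T hT => ?_
  rw [Set.mem_ofPred_eq, isStabBound_iff l hl hG.2.1] at hT
  obtain ⟨v', hv', z', hz', w', h1, h2⟩ := hT.2 (w.natLength l)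
    (show (e, phase ends l e z (w.natLength l)) ∈ _ from ⟨v, hv, z, hz, w, rfl, le_rfl⟩)
  have := hm v' hv' z' hz' w' ((phase_eq_iff l hz hz' _ _).1 h1.symm)
  exact le_trans (by exact_mod_cast this) h2

theorem stabTime_le (l : E → ℕ) (S : Set V) {T : ℝ}
    (hT : IsStabBound ends (fun e => (l e : ℝ)) S T) :
    stabTime ends (fun e => (l e : ℝ)) S ≤ T :=
  csInf_le ⟨0, fun _ h => h.1⟩ hT

/-- Vertices of the lollipop graph with `N` edges whose last edge ends at `τ`; it is a path
when `τ = N`. -/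
@[ext]
structure LollipopVertex (N τ : ℕ) : Type where
  /-- The number of the vertex. -/
  val : ℕ
  prop : val < N ∨ val = τ

/-- The second end of the edge number `i` of a lollipop graph. -/
def lollipopNext (N τ i : ℕ) : ℕ := if i + 1 < N then i + 1 else τ

theorem lollipopNext_mem (N τ i : ℕ) : lollipopNext N τ i < N ∨ lollipopNext N τ i = τ := by
  unfold lollipopNext; split_ifs <;> simp_all

/-- The lollipop graph whose edges are numbered by `σ`: the edge number `i` joins `i` to `i + 1`,
except that the last one ends at `τ`. -/
def lollipop {E : Type} {N : ℕ} (σ : E ≃ Fin N) (τ : ℕ) (f : E) : Sym2 (LollipopVertex N τ) :=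
  s(⟨σ f, Or.inl (σ f).2⟩, ⟨lollipopNext N τ (σ f), lollipopNext_mem N τ (σ f)⟩)

/-- The origin of a lollipop graph. -/
def lollipopRoot {N : ℕ} (hN : 0 < N) (τ : ℕ) : LollipopVertex N τ := ⟨0, Or.inl hN⟩

/-- Admissible positions for the end of the last edge of a lollipop graph. -/
def IsLollipopEnd (N τ : ℕ) : Prop := 1 ≤ τ ∧ (τ = N ∨ τ + 2 ≤ N)

namespace lollipop

variable {E : Type} {N τ : ℕ} {σ : E ≃ Fin N}

theorem mem_iff {f : E} {z : LollipopVertex N τ} :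
    z ∈ lollipop σ τ f ↔ z.1 = σ f ∨ z.1 = lollipopNext N τ (σ f) := by
  simp only [lollipop, Sym2.mem_iff, LollipopVertex.ext_iff]

theorem eq_mk_iff {f : E} {a b : LollipopVertex N τ} :
    lollipop σ τ f = s(a, b) ↔ (a.1 = σ f ∧ b.1 = lollipopNext N τ (σ f)) ∨
      (b.1 = σ f ∧ a.1 = lollipopNext N τ (σ f)) := by
  simp only [lollipop, Sym2.eq_iff, LollipopVertex.ext_iff]
  omega

theorem not_isDiag (hτ : IsLollipopEnd N τ) (f : E) : ¬ (lollipop σ τ f).IsDiag := by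
  obtain ⟨h1, h2⟩ := hτ
  have := (σ f).2
  rw [lollipop, Sym2.mk_isDiag_iff, LollipopVertex.ext_iff]
  simp only [lollipopNext]
  split_ifs <;> omega

theorem exists_straight (hτ : IsLollipopEnd N τ) (a b : LollipopVertex N τ) (hab : a.1 ≤ b.1) :
    ∃ w : MGWalk (lollipop σ τ) a b, ∀ f ∈ w.edges, (σ f : ℕ) < b.1 := by
  obtain ⟨h1, h2⟩ := hτ
  obtain ⟨b, hb⟩ := b
  induction b with
  | zero =>
    have : a = ⟨0, hb⟩ := LollipopVertex.ext (by simpa using hab)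
    subst this
    exact ⟨nil _, by simp⟩
  | succ b ih =>
    by_cases hab' : a.1 = b + 1
    · have : a = ⟨b + 1, hb⟩ := LollipopVertex.ext hab'
      subst this
      exact ⟨nil _, by simp⟩
    · have hbN : b < N := by omega
      obtain ⟨w, hw⟩ := ih (Or.inl hbN) (by simp only at hab ⊢; omega)
      have he : lollipop σ τ (σ.symm ⟨b, hbN⟩) = s(⟨b, Or.inl hbN⟩, ⟨b + 1, hb⟩) := by
        rw [eq_mk_iff]
        left
        simp only [Equiv.apply_symm_apply, lollipopNext, true_and]
        split_ifs <;> omega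
      refine ⟨w.append (cons _ he (nil _)), fun f hf => ?_⟩
      simp only [edges_append, edges_cons, edges_nil, List.mem_append, List.mem_singleton] at hf
      rcases hf with hf | rfl
      · have := hw f hf
        simp only at this ⊢
        omega
      · simp

theorem isDPSystem (hN : 0 < N) (hτ : IsLollipopEnd N τ) :
    IsDPSystem (lollipop σ τ) {lollipopRoot hN τ} := by
  refine ⟨?_, not_isDiag hτ, fun a b => ?_, Set.singleton_nonempty _⟩
  · refine Finite.of_injective (β := Fin (N + τ + 1)) (fun z => ⟨z.1, by have := z.2; omega⟩) ?_
    intro z z' h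
    exact LollipopVertex.ext (by simpa using h)
  · obtain ⟨p, -⟩ := exists_straight (σ := σ) hτ (lollipopRoot hN τ) a (Nat.zero_le _)
    obtain ⟨q, -⟩ := exists_straight (σ := σ) hτ (lollipopRoot hN τ) b (Nat.zero_le _)
    obtain ⟨r, -⟩ := p.exists_reverse
    exact ⟨r.append q⟩

theorem degree_root (hN : 0 < N) (hτ : IsLollipopEnd N τ) :
    degree (lollipop σ τ) (lollipopRoot hN τ) = 1 := by
  obtain ⟨h1, h2⟩ := hτ
  rw [degree, Set.ncard_eq_one]
  refine ⟨σ.symm ⟨0, hN⟩, Set.ext fun f => ?_⟩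
  rw [Set.mem_ofPred_eq, Set.mem_singleton_iff, mem_iff, Equiv.eq_symm_apply, Fin.ext_iff]
  have := (σ f).2
  simp only [lollipopRoot, lollipopNext]
  split_ifs <;> grind

theorem degree_le_three (x : LollipopVertex N τ) : degree (lollipop σ τ) x ≤ 3 := by
  have hle : degree (lollipop σ τ) x ≤ (({x.1, x.1 - 1, N - 1} : Finset ℕ) : Set ℕ).ncard := by
    refine Set.ncard_le_ncard_of_injOn (fun f => (σ f : ℕ)) ?_ ?_ (Finset.finite_toSet _)
    · intro f hf
      rw [Set.mem_ofPred_eq, mem_iff] at hf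
      have := (σ f).2
      simp only [lollipopNext] at hf
      simp only [Finset.coe_insert, Finset.coe_singleton, Set.mem_insert_iff,
        Set.mem_singleton_iff]
      split_ifs at hf <;> omega
    · intro f _ g _ h
      exact σ.injective (Fin.ext h)
  rw [Set.ncard_coe_finset] at hle
  exact hle.trans Finset.card_le_three

theorem exists_other_edge {V : Type} {ends : E → Sym2 V} {C : Set E} (hC : IsCycleSet ends C)
    {f : E} (hf : f ∈ C) {x : V} (hx : x ∈ ends f) : ∃ g ∈ C, x ∈ ends g ∧ g ≠ f := by
  have h := hC.2.2 x ⟨f, hf, hx⟩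
  have h1 : 1 < {e ∈ C | x ∈ ends e}.ncard := by
    change 1 < edgeDegree ends C x
    omega
  obtain ⟨g, ⟨hg, hxg⟩, hgf⟩ := Set.exists_ne_of_one_lt_ncard h1 f
  exact ⟨g, hg, hxg, hgf⟩

theorem cycleSet_eq (hτ : IsLollipopEnd N τ) {C : Set E} (hC : IsCycleSet (lollipop σ τ) C) :
    C = {f | τ ≤ σ f} := by
  obtain ⟨h1, h2⟩ := hτ
  have hne : ∃ i, ∃ f ∈ C, (σ f : ℕ) = i := by
    obtain ⟨f, hf⟩ := hC.1
    exact ⟨_, f, hf, rfl⟩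
  obtain ⟨f, hf, hfi⟩ := Nat.find_spec hne
  have hmin : ∀ g ∈ C, (σ f : ℕ) ≤ σ g := fun g hg => by
    rw [hfi]; exact Nat.find_min' hne ⟨g, hg, rfl⟩
  have hne' : ∀ {f g : E}, g ≠ f → (σ g : ℕ) ≠ σ f := fun h h' => h (σ.injective (Fin.ext h'))
  have hfτ : (σ f : ℕ) = τ := by
    obtain ⟨g, hg, hxg, hgf⟩ := exists_other_edge hC hf (x := ⟨σ f, Or.inl (σ f).2⟩)
      (mem_iff.2 (Or.inl rfl))
    have := hmin g hg
    have := hne' hgf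
    rw [mem_iff] at hxg
    simp only [lollipopNext] at hxg
    split_ifs at hxg <;> omega
  have hup : ∀ k, τ ≤ k → ∀ hk : k < N, σ.symm ⟨k, hk⟩ ∈ C := by
    intro k hτk
    induction k, hτk using Nat.le_induction with
    | base =>
      intro hk
      have : σ.symm ⟨τ, hk⟩ = f := by rw [Equiv.symm_apply_eq, Fin.ext_iff]; exact hfτ.symm
      rwa [this]
    | succ k hτk ih =>
      intro hk
      obtain ⟨g, hg, hxg, hgf⟩ := exists_other_edge hC (ih (by omega))
        (x := ⟨k + 1, Or.inl hk⟩) (mem_iff.2 (Or.inr (by simp [lollipopNext, hk])))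
      have h3 := hmin g hg
      have h4 := hne' hgf
      rw [mem_iff] at hxg
      simp only [Equiv.apply_symm_apply] at h4
      have : σ.symm ⟨k + 1, hk⟩ = g := by
        rw [Equiv.symm_apply_eq, Fin.ext_iff]
        simp only [lollipopNext] at hxg ⊢
        split_ifs at hxg <;> omega
      rwa [this]
  ext g
  refine ⟨fun hg => ?_, fun hg => ?_⟩
  · have := hmin g hg
    simp only [Set.mem_ofPred_eq]
    omega
  · simpa using hup (σ g) hg (σ g).2

theorem isBead (hτ : IsLollipopEnd N τ) : IsBead (lollipop σ τ) := by
  intro C₁ C₂ h1 h2 hne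
  exact absurd ((cycleSet_eq hτ h1).trans (cycleSet_eq hτ h2).symm) hne

end lollipop

theorem MGWalk.sum_crossings {E V : Type} {ends : E → Sym2 V} (χ : V → ZMod 2) (η : E → ZMod 2)
    (h : ∀ f a b, ends f = s(a, b) → η f = χ a + χ b) {a b : V} (w : MGWalk ends a b) :
    (w.edges.map η).sum = χ a + χ b := by
  induction w with
  | nil a => simp [CharTwo.add_self_eq_zero]
  | @cons a b c e he t ih =>
    rw [edges_cons, List.map_cons, List.sum_cons, ih, h e a b he]
    linear_combination zmod_two_add_self (χ b)

theorem sum_map_indicator {E : Type} (L : List E) (f₀ : E) :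
    (L.map fun f => if f = f₀ then (1 : ZMod 2) else 0).sum = L.count f₀ := by
  induction L with
  | nil => simp
  | cons g L ih =>
    rw [List.map_cons, List.sum_cons, ih, List.count_cons]
    by_cases h : g = f₀ <;> simp [h, add_comm]

namespace lollipop

variable {E : Type} {N τ : ℕ} {σ : E ≃ Fin N}

theorem eq_iff_val_eq {f g : E} : f = g ↔ (σ f : ℕ) = σ g :=
  ⟨fun h => h ▸ rfl, fun h => σ.injective (Fin.ext h)⟩

theorem count_bridge (hτ : IsLollipopEnd N τ) {a b : LollipopVertex N τ}
    (w : MGWalk (lollipop σ τ) a b) {f₀ : E} (hf₀ : (σ f₀ : ℕ) < τ) :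
    (w.edges.count f₀ : ZMod 2) =
      (if a.1 ≤ (σ f₀ : ℕ) then 1 else 0) + (if b.1 ≤ (σ f₀ : ℕ) then 1 else 0) := by
  rw [← sum_map_indicator]
  refine w.sum_crossings (fun z => if z.1 ≤ (σ f₀ : ℕ) then 1 else 0) _ ?_
  intro f a b hab
  obtain ⟨h1, h2⟩ := hτ
  have hN := (σ f).2
  simp only [eq_iff_val_eq (σ := σ)]
  rw [eq_mk_iff] at hab
  unfold lollipopNext at hab
  split_ifs at hab ⊢ <;> first | omega | rfl

theorem count_cycle (hτ : IsLollipopEnd N τ) {a b : LollipopVertex N τ} (ha : a.1 ≤ τ)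
    (hb : b.1 ≤ τ) (w : MGWalk (lollipop σ τ) a b) {f₁ f₂ : E} (h₁ : τ ≤ σ f₁) (h₂ : τ ≤ σ f₂) :
    (w.edges.count f₁ : ZMod 2) = w.edges.count f₂ := by
  wlog hle : (σ f₁ : ℕ) < σ f₂ generalizing f₁ f₂
  · rcases (not_lt.1 hle).eq_or_lt with h | h
    · rw [(eq_iff_val_eq (σ := σ)).2 h]
    · exact (this h₂ h₁ h).symm
  have key : ((w.edges.map fun f => (if f = f₁ then (1 : ZMod 2) else 0) +
      (if f = f₂ then 1 else 0)).sum) = 0 + 0 := by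
    have hz : ∀ z : LollipopVertex N τ, z.1 ≤ τ →
        (if (σ f₁ : ℕ) < z.1 ∧ z.1 ≤ (σ f₂ : ℕ) then (1 : ZMod 2) else 0) = 0 := by
      intro z hz
      rw [if_neg]
      omega
    rw [w.sum_crossings (fun z => if (σ f₁ : ℕ) < z.1 ∧ z.1 ≤ (σ f₂ : ℕ) then 1 else 0) _ ?_]
    · simp only [hz a ha, hz b hb]
    · intro f a b hab
      obtain ⟨h1, h2⟩ := hτ
      have hN := (σ f).2
      have hN₂ := (σ f₂).2
      simp only [eq_iff_val_eq (σ := σ)]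
      rw [eq_mk_iff] at hab
      unfold lollipopNext at hab
      split_ifs at hab ⊢ <;> first | omega | rfl
  rw [List.sum_map_add, sum_map_indicator, sum_map_indicator] at key
  linear_combination key - zmod_two_add_self (w.edges.count f₂ : ZMod 2)

theorem lt_of_not_mem (hτ : IsLollipopEnd N τ) {a b : LollipopVertex N τ}
    (w : MGWalk (lollipop σ τ) a b) {f₀ : E} (hf₀ : (σ f₀ : ℕ) < τ) (ha : a.1 ≤ σ f₀)
    (hw : f₀ ∉ w.edges) : ∀ g ∈ w.edges, (σ g : ℕ) < σ f₀ := by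
  induction w with
  | nil a => simp
  | @cons a b c e he t ih =>
    rw [edges_cons, List.mem_cons, not_or] at hw
    have hne : (σ f₀ : ℕ) ≠ σ e := fun h => hw.1 ((eq_iff_val_eq (σ := σ)).2 h)
    have hN := (σ e).2
    obtain ⟨h1, h2⟩ := hτ
    rw [eq_mk_iff] at he
    unfold lollipopNext at he
    have h3 : b.1 ≤ σ f₀ ∧ (σ e : ℕ) < σ f₀ := by
      split_ifs at he <;> omega
    intro g hg
    rw [edges_cons, List.mem_cons] at hg
    rcases hg with rfl | hg
    · exact h3.2
    · exact ih h3.1 hw.2 g hg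

theorem mem_edges_of_le (hτ : IsLollipopEnd N τ) (hN : 0 < N) {b : LollipopVertex N τ}
    (w : MGWalk (lollipop σ τ) (lollipopRoot hN τ) b) {f₀ g : E} (hf₀ : (σ f₀ : ℕ) < τ)
    (hg : g ∈ w.edges) (hle : (σ f₀ : ℕ) ≤ σ g) : f₀ ∈ w.edges := by
  by_contra h
  exact absurd (lt_of_not_mem hτ w hf₀ (Nat.zero_le _) h g hg) (not_lt.2 hle)

theorem exists_walk_round (hτ : IsLollipopEnd N τ) (hN : 0 < N) (hτN : τ + 2 ≤ N)
    {b : LollipopVertex N τ} (hb : b.1 ≤ τ) {f₀ : E} (hf₀ : τ ≤ σ f₀) :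
    ∃ w : MGWalk (lollipop σ τ) (lollipopRoot hN τ) b, (w.edges.count f₀ : ZMod 2) = 1 := by
  set g : E := σ.symm ⟨N - 1, by omega⟩ with hg
  have hσg : (σ g : ℕ) = N - 1 := by simp [hg]
  obtain ⟨p, hp⟩ := exists_straight (σ := σ) hτ (lollipopRoot hN τ) ⟨N - 1, by omega⟩
    (Nat.zero_le _)
  obtain ⟨q, hq⟩ := exists_straight (σ := σ) hτ b ⟨τ, Or.inr rfl⟩ hb
  obtain ⟨r, hr⟩ := q.exists_reverse
  have he : lollipop σ τ g = s(⟨N - 1, by omega⟩, ⟨τ, Or.inr rfl⟩) := by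
    rw [eq_mk_iff]
    left
    simp only [hσg, lollipopNext, true_and]
    split_ifs <;> omega
  refine ⟨p.append (cons g he r), ?_⟩
  rw [count_cycle hτ (Nat.zero_le _) hb _ hf₀ (by omega : τ ≤ σ g)]
  have h1 : g ∉ p.edges := fun h => by
    have := hp g h
    simp only at this
    omega
  have h2 : g ∉ r.edges := fun h => by
    rw [hr, List.mem_reverse] at h
    have := hq g h
    simp only at this
    omega
  simp [List.count_eq_zero_of_not_mem h1, List.count_eq_zero_of_not_mem h2]

end lollipop


theorem SameArrival.congr_left {V : Type} {L : ℕ} {z z' : V} {k₁ k₂ k' : ℕ}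
    (h : SameArrival L z k₁ z' k') (hk : k₁ ≡ k₂ [MOD 2 * L]) : SameArrival L z k₂ z' k' := by
  rcases h with ⟨h1, h2⟩ | ⟨h1, h2⟩
  · exact Or.inl ⟨h1, hk.symm.trans h2⟩
  · exact Or.inr ⟨h1, (hk.symm.add_right L).trans h2⟩

theorem natCast_zmod_two_eq_zero_or_one (k : ℕ) : (k : ZMod 2) = 0 ∨ (k : ZMod 2) = 1 := by
  generalize (k : ZMod 2) = a
  revert a
  decide

theorem List.idxOf_append_lt_length_iff {E : Type} (M K : List E) (f : E) :
    (M ++ K).idxOf f < M.length ↔ f ∈ M := by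
  rw [List.idxOf_append]
  split_ifs with h
  · simp [h, List.idxOf_lt_length_iff]
  · simp [h]

theorem exists_equiv_idxOf {E : Type} (L : List E) (hL : L.Nodup) (hmem : ∀ f, f ∈ L) :
    ∃ σ : E ≃ Fin L.length, ∀ f, (σ f : ℕ) = L.idxOf f :=
  ⟨(hL.getEquivOfForallMemList L hmem).symm, fun _ => rfl⟩

/-- Every edge of the list is reached from `v` by a walk along edges which precede it. -/
def IsSearchList (ends : E → Sym2 V) (v : V) (L : List E) : Prop :=
  ∀ L₁ f L₂, L = L₁ ++ f :: L₂ → ∃ z ∈ ends f, ∃ q : MGWalk ends v z, ∀ g ∈ q.edges, g ∈ L₁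

theorem IsSearchList.concat {v z : V} {L : List E} (hL : IsSearchList ends v L) {f : E}
    (hz : z ∈ ends f) (q : MGWalk ends v z) (hq : ∀ g ∈ q.edges, g ∈ L) :
    IsSearchList ends v (L ++ [f]) := by
  intro L₁ g L₂ h
  rcases L₂.eq_nil_or_concat with rfl | ⟨L₃, b, rfl⟩
  · obtain ⟨rfl, h2⟩ := List.append_inj' h rfl
    obtain rfl : f = g := by simpa using h2
    exact ⟨z, hz, q, hq⟩
  · rw [List.concat_eq_append, ← List.cons_append, ← List.append_assoc] at h
    exact hL L₁ g L₃ (List.append_inj' h rfl).1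

theorem MGWalk.isSearchList {v x : V} (P : MGWalk ends v x) : IsSearchList ends v P.edges := by
  intro L₁ f L₂ h
  obtain ⟨z, hz, q, hq⟩ := P.exists_initial_walk h
  exact ⟨z, hz, q, fun g hg => hq ▸ hg⟩

theorem List.forall_mem_or_exists_first {E : Type} (p : E → Prop) (M : List E) :
    (∀ g ∈ M, p g) ∨ ∃ M₁ g M₂, M = M₁ ++ g :: M₂ ∧ ¬ p g ∧ ∀ h ∈ M₁, p h := by
  induction M with
  | nil => simp
  | cons a M ih =>
    by_cases ha : p a
    · rcases ih with h | ⟨M₁, g, M₂, h1, h2, h3⟩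
      · left; simpa [ha] using h
      · exact Or.inr ⟨a :: M₁, g, M₂, by simp [h1], h2, by simpa [ha] using h3⟩
    · exact Or.inr ⟨[], a, M, rfl, ha, by simp⟩

theorem IsSearchList.exists_complete [Fintype E] (hconn : ∀ a b : V, Nonempty (MGWalk ends a b))
    {v : V}
    {L : List E} (hL : IsSearchList ends v L) (hnd : L.Nodup) :
    ∃ R, IsSearchList ends v (L ++ R) ∧ (L ++ R).Nodup ∧ ∀ f, f ∈ L ++ R := by
  induction hk : Fintype.card E - L.length generalizing L with
  | zero =>
    refine ⟨[], by simpa using hL, by simpa using hnd, fun f => ?_⟩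
    by_contra hf
    rw [List.append_nil] at hf
    have := (List.nodup_cons.2 ⟨hf, hnd⟩).length_le_card
    simp only [List.length_cons] at this
    omega
  | succ k ih =>
    by_cases hall : ∀ f, f ∈ L
    · exact ⟨[], by simpa using hL, by simpa using hnd, by simpa using hall⟩
    push Not at hall
    obtain ⟨f, hf⟩ := hall
    obtain ⟨g, hg, z, hz, q, hq⟩ : ∃ g, g ∉ L ∧ ∃ z ∈ ends g, ∃ q : MGWalk ends v z,
        ∀ h ∈ q.edges, h ∈ L := by
      obtain ⟨w⟩ := hconn v (ends f).out.1
      rcases List.forall_mem_or_exists_first (· ∈ L) w.edges with h | ⟨M₁, g, M₂, h1, h2, h3⟩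
      · exact ⟨f, hf, _, Sym2.out_fst_mem _, w, h⟩
      · obtain ⟨z, hz, q, hq⟩ := w.exists_initial_walk h1
        exact ⟨g, h2, z, hz, q, fun h hh => h3 h (hq ▸ hh)⟩
    have hnd' : (L ++ [g]).Nodup := by
      rw [List.nodup_append_comm]
      exact List.nodup_cons.2 ⟨hg, hnd⟩
    obtain ⟨R, h1, h2, h3⟩ := ih (hL.concat hz q hq) hnd' (by simp; omega)
    exact ⟨g :: R, by simpa using h1, by simpa using h2, by simpa using h3⟩

/-- A trail followed by one more edge starts an enumeration of the edges in which every edge is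
reached along previous edges. -/
theorem exists_search_order [Fintype E] (hconn : ∀ a b : V, Nonempty (MGWalk ends a b)) {v x : V}
    (P : MGWalk ends v x) (hP : P.edges.Nodup) {e : E} (he : e ∉ P.edges) (hx : x ∈ ends e) :
    ∃ (N : ℕ) (σ : E ≃ Fin N), (∀ f, (σ f : ℕ) < σ e ↔ f ∈ P.edges) ∧
      ∀ f, ∃ z ∈ ends f, ∃ q : MGWalk ends v z, ∀ g ∈ q.edges, (σ g : ℕ) < σ f := by
  have hnd : (P.edges ++ [e]).Nodup := by
    rw [List.nodup_append_comm]
    exact List.nodup_cons.2 ⟨he, hP⟩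
  obtain ⟨R, h1, h2, h3⟩ := (P.isSearchList.concat hx P fun _ h => h).exists_complete hconn hnd
  obtain ⟨σ, hσ⟩ := exists_equiv_idxOf _ h2 h3
  have key : ∀ L₁ f L₂, P.edges ++ [e] ++ R = L₁ ++ f :: L₂ → f ∉ L₁ →
      ∀ g, (σ g : ℕ) < σ f ↔ g ∈ L₁ := by
    intro L₁ f L₂ h hf g
    rw [hσ, hσ, h, List.idxOf_append_of_notMem hf, List.idxOf_cons_self, add_zero,
      List.idxOf_append_lt_length_iff]
  refine ⟨_, σ, key P.edges e R (by simp) he, fun f => ?_⟩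
  obtain ⟨L₁, L₂, h4, h5⟩ := List.eq_append_cons_of_mem (h3 f)
  obtain ⟨z, hz, q, hq⟩ := h1 L₁ f L₂ h4
  exact ⟨z, hz, q, fun g hg => (key L₁ f L₂ h4 h5 g).2 (hq g hg)⟩

/-- An enumeration of the edges which starts with `A`, then `e`, and ends with `C`. -/
theorem exists_order [Fintype E] (A C : Finset E) {e : E} (hA : e ∉ A) (hC : e ∉ C)
    (hAC : Disjoint A C) :
    ∃ (τ : ℕ) (σ : E ≃ Fin (τ + C.card)), (∀ f, (σ f : ℕ) < σ e ↔ f ∈ A) ∧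
      (∀ f, (σ f : ℕ) < τ ↔ f ∉ C) := by
  set M : List E := A.toList ++ e :: ((A ∪ C ∪ {e})ᶜ : Finset E).toList with hM
  have hMmem : ∀ f, f ∈ M ↔ f ∉ C := by
    intro f
    have h1 : f ∈ A → f ∉ C := fun h => Finset.disjoint_left.1 hAC h
    by_cases h2 : f = e
    · subst h2; simp [hM, hC]
    · simp only [hM, List.mem_append, Finset.mem_toList, List.mem_cons, Finset.mem_compl,
        Finset.mem_union, Finset.mem_singleton]
      tauto
  have hnd : (M ++ C.toList).Nodup := by
    refine List.Nodup.append ?_ C.nodup_toList fun f h1 h2 =>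
      (hMmem f).1 h1 (Finset.mem_toList.1 h2)
    refine List.Nodup.append A.nodup_toList (List.nodup_cons.2 ⟨by simp, Finset.nodup_toList _⟩) ?_
    intro f h1 h2
    rw [Finset.mem_toList] at h1
    rcases List.mem_cons.1 h2 with rfl | h2
    · exact hA h1
    · simp [h1] at h2
  have hlen : (M ++ C.toList).length = M.length + C.card := by simp
  obtain ⟨σ, hσ⟩ := exists_equiv_idxOf (M ++ C.toList) hnd fun f => by
    rw [List.mem_append, hMmem, Finset.mem_toList]
    tauto
  refine ⟨M.length, σ.trans (finCongr hlen), fun f => ?_, fun f => ?_⟩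
  · have h : M ++ C.toList = A.toList ++ e :: (((A ∪ C ∪ {e})ᶜ : Finset E).toList ++ C.toList) := by
      simp [hM]
    simp only [Equiv.trans_apply, finCongr_apply, Fin.val_cast, hσ]
    have he : (M ++ C.toList).idxOf e = A.toList.length := by
      rw [h, List.idxOf_append_of_notMem (by simpa using hA), List.idxOf_cons_self, add_zero]
    rw [he, h, List.idxOf_append_lt_length_iff, Finset.mem_toList]
  · simp only [Equiv.trans_apply, finCongr_apply, Fin.val_cast, hσ]
    rw [List.idxOf_append_lt_length_iff, hMmem]

namespace lollipop

variable {N τ : ℕ} {σ : E ≃ Fin N}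

theorem val_eq_of_mem (hτ : IsLollipopEnd N τ) {e : E} (he : (σ e : ℕ) < τ)
    {z P : LollipopVertex N τ} (hP : P.1 = σ e) (hz : z ∈ lollipop σ τ e) :
    (z = P ∧ z.1 = σ e) ∨ (z ≠ P ∧ z.1 = σ e + 1) := by
  obtain ⟨h1, h2⟩ := hτ
  have := (σ e).2
  rw [mem_iff] at hz
  rw [ne_eq, LollipopVertex.ext_iff, hP]
  unfold lollipopNext at hz
  split_ifs at hz <;> omega

theorem count_root_bridge (hτ : IsLollipopEnd N τ) (hN : 0 < N) {e : E} (he : (σ e : ℕ) < τ)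
    {z P : LollipopVertex N τ} (hP : P.1 = σ e) (hz : z ∈ lollipop σ τ e)
    (w : MGWalk (lollipop σ τ) (lollipopRoot hN τ) z) {f : E} (hf : (σ f : ℕ) < τ) :
    (w.edges.count f : ZMod 2) =
      if (σ f : ℕ) < σ e ∨ (f = e ∧ z ≠ P) then 1 else 0 := by
  have hz' := val_eq_of_mem hτ he hP hz
  rw [count_bridge hτ w hf, if_pos (show (lollipopRoot hN τ).1 ≤ σ f from Nat.zero_le _),
    eq_iff_val_eq (σ := σ)]
  by_cases h : z.1 ≤ (σ f : ℕ)
  · rw [if_pos h, if_neg (by grind)]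
    rfl
  · rw [if_neg h, if_pos (by grind), add_zero]

/-- A walk to an end of `e` in a lollipop graph has the edge multiplicities of a walk in another
graph, if the parities are those of a reference walk and the traversed edges are connected. -/
theorem exists_walk_transport [Fintype E] (hd : ∀ e, ¬ (ends e).IsDiag) (hτ : IsLollipopEnd N τ)
    (hN : 0 < N)
    {v x y : V} {e : E} (hxy : ends e = s(x, y)) (w₀ : MGWalk ends v x) (he : (σ e : ℕ) < τ)
    {z P : LollipopVertex N τ} (hP : P.1 = σ e) (hz : z ∈ lollipop σ τ e)
    (w : MGWalk (lollipop σ τ) (lollipopRoot hN τ) z)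
    (hw : ∀ f, f ≠ e → (w.edges.count f : ZMod 2) = w₀.edges.count f)
    (hwe : (w₀.edges.count e : ZMod 2) = 0)
    (hc : ∀ f ∈ w.edges, ∃ u ∈ ends f, ∃ q : MGWalk ends v u, ∀ g ∈ q.edges, g ∈ w.edges) :
    ∃ w' : MGWalk ends v (if z = P then x else y), ∀ f, w'.edges.count f = w.edges.count f := by
  have hpos : ∀ f, 0 < w.edges.count f ↔ f ∈ w.edges := fun f => List.count_pos_iff
  refine exists_walk_count_eq hd _ (fun u => ?_) (by simpa only [hpos] using hc)
  have h0 := degParity_count hd w₀ u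
  have hcount := count_root_bridge hτ hN he hP hz w he
  by_cases hzP : z = P
  · rw [if_pos hzP, ← h0]
    refine degParity_congr (fun f => ?_) u
    by_cases hf : f = e
    · subst hf
      simp [hcount, hwe, hzP]
    · exact hw f hf
  · rw [if_neg hzP, degParity_congr (m := fun f => w₀.edges.count f + if f = e then 1 else 0),
      degParity_add, h0, degParity_single hd hxy]
    · linear_combination zmod_two_add_self (eqInd u x)
    · intro f
      by_cases hf : f = e
      · subst hf
        simp [hcount, hwe, hzP]
      · simp [hw f hf, hf]

theorem le_stabTime_of_walks [Fintype E] [Nonempty E] (l : E → ℕ) (hl : ∀ e, 0 < l e)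
    (hτ : IsLollipopEnd N τ) (hN : 0 < N) {v x y : V} {e : E} (hxy : ends e = s(x, y))
    (hne : x ≠ y) (m k : ℕ)
    (hm : ∀ z ∈ ends e, ∀ w : MGWalk ends v z,
      SameArrival (l e) x k z (w.natLength l) → m ≤ w.natLength l)
    {P : LollipopVertex N τ} (hP : P.1 = σ e)
    (b : MGWalk (lollipop σ τ) (lollipopRoot hN τ) P) (n : E → ℕ) (hpos : ∀ f, 0 < n f)
    (hn : ∀ f, (n f : ZMod 2) = b.edges.count f) (hlen : ∑ f, n f * l f ≡ k [MOD 2 * l e])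
    (ht : ∀ z ∈ lollipop σ τ e, ∀ w : MGWalk (lollipop σ τ) (lollipopRoot hN τ) z,
      SameArrival (l e) P k z (w.natLength l) →
      ∃ w' : MGWalk ends v (if z = P then x else y), ∀ f, w'.edges.count f = w.edges.count f) :
    (m : ℝ) ≤ stabTime (lollipop σ τ) (fun e => (l e : ℝ)) {lollipopRoot hN τ} := by
  have hG := isDPSystem (σ := σ) hN hτ
  obtain ⟨w₁, hw₁⟩ := exists_walk_count_eq hG.2.1 n
    (fun z => (degParity_congr hn z).trans (degParity_count hG.2.1 b z)) fun f _ => by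
      obtain ⟨q⟩ := hG.2.2.1 (lollipopRoot hN τ) (lollipop σ τ f).out.1
      exact ⟨_, Sym2.out_fst_mem _, q, fun g _ => hpos g⟩
  refine le_stabTime l hl hG m (Set.mem_singleton _) (mem_iff.2 (Or.inl hP)) w₁ ?_
  intro r hr z hz w hsame
  obtain rfl := Set.mem_singleton_iff.1 hr
  have hw₁len : w₁.natLength l = ∑ f, n f * l f := by simp [natLength_eq_sum, hw₁]
  rw [hw₁len] at hsame
  replace hsame := hsame.congr_left hlen
  obtain ⟨w', hw'⟩ := ht z hz w hsame
  have hlen' : w'.natLength l = w.natLength l := by simp [natLength_eq_sum, hw']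
  rw [← hlen'] at hsame ⊢
  refine hm _ ?_ w' ?_
  · rw [hxy, Sym2.mem_iff]
    split_ifs <;> simp
  · by_cases hzP : z = P
    · subst hzP
      exact Or.inl ⟨(if_pos rfl).symm, by simpa [SameArrival] using hsame⟩
    · refine Or.inr ⟨by rwa [if_neg hzP], ?_⟩
      exact (hsame.resolve_left fun h => hzP h.1.symm).2

/-- The case of a path: the odd part of the critical walk may be replaced by a trail. -/
theorem le_stabTime_path [Fintype E] [Nonempty E] (l : E → ℕ) (hl : ∀ e, 0 < l e)
    (hd : ∀ e, ¬ (ends e).IsDiag) (hN : 0 < N) {v x y : V} {e : E} (hxy : ends e = s(x, y))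
    (m k : ℕ)
    (hm : ∀ z ∈ ends e, ∀ w : MGWalk ends v z,
      SameArrival (l e) x k z (w.natLength l) → m ≤ w.natLength l)
    (P : MGWalk ends v x) (hP : P.edges.Nodup)
    (hσP : ∀ f, (σ f : ℕ) < σ e ↔ f ∈ P.edges)
    (hσ : ∀ f, ∃ z ∈ ends f, ∃ q : MGWalk ends v z, ∀ g ∈ q.edges, (σ g : ℕ) < σ f)
    (n : E → ℕ) (hn : ∀ f, (n f : ZMod 2) = P.edges.count f)
    (hlen : ∑ f, n f * l f ≡ k [MOD 2 * l e]) :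
    (m : ℝ) ≤ stabTime (lollipop σ N) (fun e => (l e : ℝ)) {lollipopRoot hN N} := by
  have hτ : IsLollipopEnd N N := ⟨hN, Or.inl rfl⟩
  have hlt : ∀ f, (σ f : ℕ) < N := fun f => (σ f).2
  have hcount : ∀ f, (P.edges.count f : ZMod 2) = if (σ f : ℕ) < σ e then 1 else 0 := by
    intro f
    by_cases hf : f ∈ P.edges
    · simp [hσP, hf, List.count_eq_one_of_mem hP hf]
    · simp [hσP, hf, List.count_eq_zero_of_not_mem hf]
  set Q : LollipopVertex N N := ⟨σ e, Or.inl (σ e).2⟩ with hQ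
  obtain ⟨b, -⟩ := exists_straight (σ := σ) hτ (lollipopRoot hN N) Q (Nat.zero_le _)
  have hQe : Q ∈ lollipop σ N e := mem_iff.2 (Or.inl rfl)
  have hne : x ≠ y := by
    have := hd e
    rwa [hxy, Sym2.mk_isDiag_iff] at this
  refine le_stabTime_of_walks l hl hτ hN hxy hne m k hm (P := Q) rfl b
    (fun f => n f + 2 * l e) (fun f => by have := hl e; omega) (fun f => ?_) ?_ ?_
  · rw [count_root_bridge hτ hN (hlt e) (P := Q) rfl hQe b (hlt f)]
    have : ((2 : ℕ) : ZMod 2) = 0 := rfl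
    simp only [Nat.cast_add, Nat.cast_mul, this, zero_mul, add_zero, hn, hcount, ne_eq, not_true,
      and_false, or_false]
  · simp only [add_mul, Finset.sum_add_distrib]
    rw [← Finset.mul_sum _ _ (2 * l e)]
    exact (Nat.ModEq.symm (by simp [Nat.ModEq])).trans hlen
  · intro z hz w _
    refine exists_walk_transport hd hτ hN hxy P (hlt e) (P := Q) rfl hz w
      (fun f hf => ?_) ?_ fun f hf => ?_
    · rw [count_root_bridge hτ hN (hlt e) (P := Q) rfl hz w (hlt f), hcount]
      simp [hf]
    · simp [hcount]
    · obtain ⟨u, hu, q, hq⟩ := hσ f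
      exact ⟨u, hu, q, fun g hg => mem_edges_of_le hτ hN w (hlt g) hf (hq g hg).le⟩

/-- The case of a proper lollipop: its cycle consists of the odd edges of the critical walk which
are not on the trail. -/
theorem le_stabTime_cycle [Fintype E] [Nonempty E] (l : E → ℕ) (hl : ∀ e, 0 < l e)
    (hG : (∀ e, ¬ (ends e).IsDiag) ∧ ∀ a b : V, Nonempty (MGWalk ends a b)) (hN : 0 < N)
    (hτ : IsLollipopEnd N τ) (hτN : τ + 2 ≤ N) {v x y : V} {e : E} (hxy : ends e = s(x, y))
    (m : ℕ) (u : MGWalk ends v x)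
    (hm : ∀ z ∈ ends e, ∀ w : MGWalk ends v z,
      SameArrival (l e) x (u.natLength l) z (w.natLength l) → m ≤ w.natLength l)
    (he : (σ e : ℕ) < τ)
    (hu : ∀ f, (u.edges.count f : ZMod 2) = if (σ f : ℕ) < σ e ∨ τ ≤ σ f then 1 else 0)
    (hno : ∀ n : E → ℕ, (∀ f, (n f : ZMod 2) = if (σ f : ℕ) < σ e then 1 else 0) →
      ¬ ∑ f, n f * l f ≡ u.natLength l [MOD 2 * l e]) :
    (m : ℝ) ≤ stabTime (lollipop σ τ) (fun e => (l e : ℝ)) {lollipopRoot hN τ} := by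
  obtain ⟨hd, hconn⟩ := hG
  obtain ⟨f₀, hf₀τ⟩ : ∃ f₀, τ ≤ (σ f₀ : ℕ) :=
    ⟨σ.symm ⟨N - 1, by omega⟩, by rw [Equiv.apply_symm_apply]; simp only; omega⟩
  set P : LollipopVertex N τ := ⟨σ e, Or.inl (σ e).2⟩ with hP
  have hPe : P ∈ lollipop σ τ e := mem_iff.2 (Or.inl rfl)
  have hne : x ≠ y := by
    have := hd e
    rwa [hxy, Sym2.mk_isDiag_iff] at this
  have hroot : (lollipopRoot hN τ).1 ≤ τ := Nat.zero_le _
  obtain ⟨b, hb⟩ := exists_walk_round hτ hN hτN (b := P) he.le hf₀τ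
  refine le_stabTime_of_walks l hl hτ hN hxy hne m (u.natLength l) hm (P := P) rfl b
    (fun f => u.edges.count f + 2 * l e) (fun f => by have := hl e; omega) (fun f => ?_) ?_ ?_
  · have : ((2 : ℕ) : ZMod 2) = 0 := rfl
    simp only [Nat.cast_add, Nat.cast_mul, this, zero_mul, add_zero, hu]
    rcases lt_or_ge (σ f : ℕ) τ with hf | hf
    · rw [count_root_bridge hτ hN he (P := P) rfl hPe b hf]
      simp [hf.not_ge]
    · rw [count_cycle hτ hroot he.le b hf hf₀τ, hb]
      simp [hf]
  · simp only [add_mul, Finset.sum_add_distrib]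
    rw [← Finset.mul_sum _ _ (2 * l e),
      ← natLength_eq_sum]
    simp [Nat.ModEq]
  · intro z hz w hsame
    have hzτ : z.1 ≤ τ := by
      rcases val_eq_of_mem hτ he (P := P) rfl hz with h | h <;> omega
    have hcyc : ∀ f, τ ≤ (σ f : ℕ) → (w.edges.count f : ZMod 2) = w.edges.count f₀ :=
      fun f hf => count_cycle hτ hroot hzτ w hf hf₀τ
    have hbr : ∀ f, (σ f : ℕ) < τ → _ := fun f hf => count_root_bridge hτ hN he (P := P) rfl hz w hf
    rcases natCast_zmod_two_eq_zero_or_one (w.edges.count f₀) with h0 | h1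
    · exfalso
      refine hno (fun f => w.edges.count f + if f = e then (if z = P then 0 else 1) else 0)
        (fun f => ?_) ?_
      · rcases lt_or_ge (σ f : ℕ) τ with hf | hf
        · by_cases hfe : f = e
          · subst hfe
            by_cases hzP : z = P
            · simp [hbr f hf, hzP]
            · simp [hbr f hf, hzP, zmod_two_add_self]
          · simp [hbr f hf, hfe]
        · have hfe : f ≠ e := by rintro rfl; omega
          have : ¬ (σ f : ℕ) < σ e := by omega
          rw [if_neg hfe, add_zero, hcyc f hf, h0, if_neg this]
      · simp only [add_mul, Finset.sum_add_distrib, ite_mul, zero_mul, one_mul,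
          Finset.sum_ite_eq', Finset.mem_univ, if_true]
        rw [← natLength_eq_sum]
        rcases hsame with ⟨h2, h3⟩ | ⟨h2, h3⟩
        · simpa [h2.symm] using h3.symm
        · rw [if_neg h2.symm]
          refine (h3.symm.add_right (l e)).trans ?_
          rw [add_assoc, ← two_mul]
          simp [Nat.ModEq]
    · have hcount : ∀ f, τ ≤ (σ f : ℕ) → f ∈ w.edges := fun f hf => by
        by_contra hmem
        have := hcyc f hf
        rw [h1, List.count_eq_zero_of_not_mem hmem] at this
        exact absurd this (by decide)
      have hall : ∀ f, f ∈ w.edges := fun f => by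
        rcases lt_or_ge (σ f : ℕ) τ with hf | hf
        · exact mem_edges_of_le hτ hN w hf (hcount f₀ hf₀τ) (by omega)
        · exact hcount f hf
      refine exists_walk_transport hd hτ hN hxy u he (P := P) rfl hz w
        (fun f hf => ?_) ?_ fun f _ => ?_
      · rcases lt_or_ge (σ f : ℕ) τ with hfτ | hfτ
        · rw [hbr f hfτ, hu]
          simp [hf, hfτ.not_ge]
        · rw [hcyc f hfτ, h1, hu]
          simp [hfτ]
      · rw [hu]
        simp [he]
      · obtain ⟨q⟩ := hconn v (ends f).out.1
        exact ⟨_, Sym2.out_fst_mem _, q, fun g _ => hall g⟩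

end lollipop

theorem MGWalk.count_ne_add_single [Fintype E] (hd : ∀ e, ¬ (ends e).IsDiag) {a b : V}
    (u P : MGWalk ends a b) (c : E)
    (h : ∀ f, (u.edges.count f : ZMod 2) = P.edges.count f + if f = c then 1 else 0) : False := by
  obtain ⟨x, y, hxy⟩ : ∃ x y, ends c = s(x, y) := by
    induction h : ends c with
    | _ x y => exact ⟨x, y, rfl⟩
  have hne : x ≠ y := by
    have := hd c
    rwa [hxy, Sym2.mk_isDiag_iff] at this
  have key := degParity_congr (ends := ends) (n := fun f => u.edges.count f)
    (m := fun f => P.edges.count f + if f = c then 1 else 0) (fun f => by simp [h f]) x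
  rw [degParity_add, degParity_count hd, degParity_count hd, degParity_single hd hxy] at key
  have h2 : eqInd x x + eqInd x y = (1 : ZMod 2) := by simp [eqInd, hne]
  rw [h2] at key
  exact one_ne_zero (left_eq_add.1 key)

/-- The critical walk of a system may be chosen to traverse the critical edge an even number of
times. -/
theorem exists_even_walk_stabTime [Fintype E] [Nonempty E] (l : E → ℕ) (hl : ∀ e, 0 < l e)
    {S : Set V}
    (hG : IsDPSystem ends S) :
    ∃ (m : ℕ) (v x y : V) (e : E) (u : MGWalk ends v x),
      stabTime ends (fun e => (l e : ℝ)) S ≤ m ∧ ends e = s(x, y) ∧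
      (u.edges.count e : ZMod 2) = 0 ∧
      ∀ z ∈ ends e, ∀ w : MGWalk ends v z,
        SameArrival (l e) x (u.natLength l) z (w.natLength l) → m ≤ w.natLength l := by
  obtain ⟨v, hv, e, z, hz, w, hT, hm⟩ := exists_walk_stabTime l hl hG
  obtain ⟨y, hy⟩ := hz
  have hzy : z ≠ y := by
    have := hG.2.1 e
    rwa [hy, Sym2.mk_isDiag_iff] at this
  have hze : z ∈ ends e := by simp [hy]
  have hye : y ∈ ends e := by simp [hy]
  rcases natCast_zmod_two_eq_zero_or_one (w.edges.count e) with h | h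
  · exact ⟨_, v, z, y, e, w, stabTime_le l S hT, hy, h, hm v hv⟩
  · refine ⟨_, v, y, z, e, w.append (cons e hy (nil y)), stabTime_le l S hT,
      by rw [hy, Sym2.eq_swap], by simp [h, zmod_two_add_self], fun z' hz' w' hs => hm v hv z' hz' w' ?_⟩
    rw [← phase_eq_iff l hye hz'] at hs
    rw [← phase_eq_iff l hze hz', ← hs, phase_eq_iff l hze hye, natLength_append]
    exact Or.inr ⟨hzy, by simp [natLength, Nat.ModEq]⟩

/-- Every system is dominated by a lollipop graph with the same edges. -/
theorem exists_stabTime_le_lollipop [Fintype E] [Nonempty E] (l : E → ℕ) (hl : ∀ e, 0 < l e)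
    {S : Set V}
    (hG : IsDPSystem ends S) :
    ∃ (N τ : ℕ) (σ : E ≃ Fin N) (hN : 0 < N), IsLollipopEnd N τ ∧
      stabTime ends (fun e => (l e : ℝ)) S ≤
        stabTime (lollipop σ τ) (fun e => (l e : ℝ)) {lollipopRoot hN τ} := by
  obtain ⟨m, v, x, y, e, u, hmS, hxy, hue, hm⟩ := exists_even_walk_stabTime l hl hG
  obtain ⟨-, hd, hconn, -⟩ := hG
  have hparity : ∀ f, (((if (u.edges.count f : ZMod 2) = 1 then 1 else 0 : ℕ)) : ZMod 2) =
      u.edges.count f := fun f => by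
    rcases natCast_zmod_two_eq_zero_or_one (u.edges.count f) with h | h <;> simp [h]
  obtain ⟨P, hP⟩ := exists_walk_count_le hd
    (fun f => if (u.edges.count f : ZMod 2) = 1 then 1 else 0)
    fun z => (degParity_congr hparity z).trans (degParity_count hd u z)
  have hPnd : P.edges.Nodup := List.nodup_iff_count_le_one.2 fun f => by
    have := hP f
    split_ifs at this <;> omega
  have hPodd : ∀ f ∈ P.edges, (u.edges.count f : ZMod 2) = 1 := fun f hf => by
    by_contra h
    have := hP f
    rw [if_neg h, Nat.le_zero, List.count_eq_zero] at this
    exact this hf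
  have heP : e ∉ P.edges := fun h => by
    have := hPodd e h
    rw [hue] at this
    exact absurd this (by decide)
  have hPcount : ∀ f, P.edges.count f = if f ∈ P.edges then 1 else 0 := fun f => by
    split_ifs with hf
    · exact List.count_eq_one_of_mem hPnd hf
    · exact List.count_eq_zero_of_not_mem hf
  by_cases hcase : ∃ n : E → ℕ, (∀ f, (n f : ZMod 2) = P.edges.count f) ∧
      ∑ f, n f * l f ≡ u.natLength l [MOD 2 * l e]
  · obtain ⟨n, hn, hlen⟩ := hcase
    obtain ⟨N, σ, h1, h2⟩ := exists_search_order hconn P hPnd heP (by simp [hxy])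
    have hN : 0 < N := (Nat.zero_le _).trans_lt (σ e).2
    exact ⟨N, N, σ, hN, ⟨hN, Or.inl rfl⟩, hmS.trans
      (lollipop.le_stabTime_path l hl hd hN hxy m _ hm P hPnd h1 h2 n hn hlen)⟩
  · push Not at hcase
    set C : Finset E := {f | (u.edges.count f : ZMod 2) = 1 ∧ f ∉ P.edges} with hC
    have hu : ∀ f, (u.edges.count f : ZMod 2) = if f ∈ P.edges ∨ f ∈ C then 1 else 0 := fun f => by
      by_cases hf : f ∈ P.edges
      · simp [hf, hPodd f hf]
      · rcases natCast_zmod_two_eq_zero_or_one (u.edges.count f) with h | h <;> simp [hC, hf, h]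
    have hCcard : 2 ≤ C.card := by
      by_contra hlt
      have hCP : ∀ f ∈ C, f ∉ P.edges := fun f hf => (Finset.mem_filter.1 hf).2.2
      rcases Nat.le_one_iff_eq_zero_or_eq_one.1 (Nat.lt_succ_iff.1 (not_le.1 hlt)) with h | h
      · refine hcase (fun f => u.edges.count f) (fun f => ?_) (by rw [← natLength_eq_sum])
        rw [hu, hPcount, Finset.card_eq_zero.1 h]
        simp
      · obtain ⟨c, hc⟩ := Finset.card_eq_one.1 h
        refine MGWalk.count_ne_add_single hd u P c fun f => ?_
        rw [hu, hPcount]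
        by_cases hf : f = c
        · have := hCP c (by simp [hc])
          simp [hf, this, hc]
        · simp [hf, hc]
    obtain ⟨τ, σ, h1, h2⟩ := exists_order P.edges.toFinset C (e := e) (by simpa using heP)
      (by simp [hC, hue]) (Finset.disjoint_left.2 fun f hf hf' => by
        simp only [hC, Finset.mem_filter] at hf'
        exact hf'.2.2 (List.mem_toFinset.1 hf))
    have heτ : (σ e : ℕ) < τ := (h2 e).2 (by simp [hC, hue])
    have hτ : IsLollipopEnd (τ + C.card) τ := ⟨by omega, Or.inr (by omega)⟩
    have h1' : ∀ f, f ∈ P.edges ↔ (σ f : ℕ) < σ e := fun f => by rw [h1, List.mem_toFinset]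
    have h2' : ∀ f, f ∈ C ↔ τ ≤ (σ f : ℕ) := fun f => by rw [← not_lt, h2, not_not]
    refine ⟨_, τ, σ, by omega, hτ, hmS.trans
      (lollipop.le_stabTime_cycle l hl ⟨hd, hconn⟩ (by omega) hτ (by omega) hxy m u hm heτ
        (fun f => ?_) fun n hn => hcase n fun f => ?_)⟩
    · simp only [hu, h1', h2']
    · rw [hn, hPcount]
      simp [h1']

/-- Some lollipop graph has maximal stabilization time. -/
theorem exists_lollipop_isMaxStab {E : Type} [Fintype E] [Nonempty E] (l : E → ℕ)
    (hl : ∀ e, 0 < l e) :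
    ∃ (N τ : ℕ) (σ : E ≃ Fin N) (hN : 0 < N), IsLollipopEnd N τ ∧
      IsMaxStab (fun e => (l e : ℝ)) (lollipop σ τ) {lollipopRoot hN τ} := by
  set N := Fintype.card E with hNdef
  have hN : 0 < N := Fintype.card_pos
  let A : Set ((E ≃ Fin N) × Fin (N + 1)) := {p | IsLollipopEnd N p.2}
  obtain ⟨p, hp, hmax⟩ := Set.exists_max_image A
    (fun p => stabTime (lollipop p.1 p.2) (fun e => (l e : ℝ)) {lollipopRoot hN p.2})
    (Set.toFinite A) ⟨(Fintype.equivFin E, Fin.last N), hN, Or.inl (by simp)⟩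
  refine ⟨N, p.2, p.1, hN, hp, fun V' ends' S' hG' => ?_⟩
  obtain ⟨N', τ, σ, hN', hτ, hle⟩ := exists_stabTime_le_lollipop l hl hG'
  obtain rfl : N' = N := by rw [hNdef, Fintype.card_congr σ, Fintype.card_fin]
  exact hle.trans (hmax (σ, ⟨τ, by have := hτ.2; omega⟩) hτ)

end
/-- among all DP-systems on connected metric graphs assembled from a
finite edge set `E` with positive integer lengths, some system of maximal
stabilization time lives on a bead graph with all degrees at most three and has a
single initial vertex of degree one. -/
theorem stmt0 {E : Type} [Fintype E] [Nonempty E] (l : E → ℕ) (hl : ∀ e, 0 < l e) :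
    ∃ (V : Type) (ends : E → Sym2 V) (v₀ : V),
      IsDPSystem ends {v₀} ∧
      IsBead ends ∧
      (∀ x : V, degree ends x ≤ 3) ∧
      degree ends v₀ = 1 ∧
      IsMaxStab (fun e => (l e : ℝ)) ends {v₀} := by
  obtain ⟨N, τ, σ, hN, hτ, hmax⟩ := exists_lollipop_isMaxStab l hl
  exact ⟨LollipopVertex N τ, lollipop σ τ, lollipopRoot hN τ, lollipop.isDPSystem hN hτ,
    lollipop.isBead hτ, lollipop.degree_le_three, lollipop.degree_root hN hτ, hmax⟩
end

section
/- Let E be a finite set of edges with positive integer length function l. Then LSTDP(E) contains a DP-system whose underlying graph is a bead graph and whose initial set consists of a single vertex. -/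
open scoped symmDiff

/-- There is a walk from `u` to `v` of length `n`. -/
def Reach {E V : Type} (ends : E → Sym2 V) (l : E → ℕ) (u v : V) (n : ℕ) : Prop :=
  ∃ w : MGWalk ends u v, w.length (fun e => (l e : ℝ)) = n

namespace Reach

variable {E V V' : Type} {ends : E → Sym2 V} {ends' : E → Sym2 V'} {l : E → ℕ}

theorem refl (u : V) : Reach ends l u u 0 := ⟨.nil u, by simp [MGWalk.length]⟩

theorem cons {a b c : V} {e : E} {n : ℕ} (h : ends e = s(a, b)) (hr : Reach ends l b c n) :
    Reach ends l a c (l e + n) := by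
  obtain ⟨w, hw⟩ := hr
  exact ⟨.cons e h w, by simp [MGWalk.length, hw]⟩

theorem of_walk {a b : V} (w : MGWalk ends a b) :
    ∃ n : ℕ, Reach ends l a b n ∧ w.length (fun e => (l e : ℝ)) = n := by
  suffices h : ∃ n : ℕ, w.length (fun e => (l e : ℝ)) = n by
    obtain ⟨n, hn⟩ := h
    exact ⟨n, ⟨w, hn⟩, hn⟩
  induction w with
  | nil a => exact ⟨0, by simp [MGWalk.length]⟩
  | cons e h tail ih =>
    obtain ⟨m, hm⟩ := ih
    exact ⟨l e + m, by simp [MGWalk.length, hm]⟩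

theorem induction {P : V → V → ℕ → Prop} (hnil : ∀ a, P a a 0)
    (hcons : ∀ a b c e n, ends e = s(a, b) → Reach ends l b c n → P b c n → P a c (l e + n))
    {a b : V} {n : ℕ} (h : Reach ends l a b n) : P a b n := by
  obtain ⟨w, hw⟩ := h
  induction w generalizing n with
  | nil a =>
    simp only [MGWalk.length] at hw
    obtain rfl : n = 0 := by exact_mod_cast hw.symm
    exact hnil a
  | @cons a b c e h tail ih =>
    obtain ⟨m, hr, hm⟩ := of_walk (l := l) tail
    simp only [MGWalk.length, hm] at hw
    obtain rfl : n = l e + m := by exact_mod_cast hw.symm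
    exact hcons a b c e m h hr (ih hm)

theorem trans {a b c : V} {m n : ℕ} (h : Reach ends l a b m) (h' : Reach ends l b c n) :
    Reach ends l a c (m + n) := by
  refine induction (P := fun a b m => Reach ends l b c n → Reach ends l a c (m + n))
    ?_ ?_ h h'
  · intro a h; simpa using h
  · intro a b d e m he _ ih hd
    rw [add_assoc]
    exact cons he (ih hd)

theorem edge {a b : V} {e : E} (h : ends e = s(a, b)) : Reach ends l a b (l e) := by
  simpa using cons h (refl (l := l) b)

theorem symm {a b : V} {n : ℕ} (h : Reach ends l a b n) : Reach ends l b a n := by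
  refine induction (P := fun a b n => Reach ends l b a n) refl ?_ h
  intro a b c e n he _ ih
  rw [add_comm]
  exact ih.trans (edge (he.trans Sym2.eq_swap))

theorem map {φ : V → V'} (hφ : ∀ e, (ends e).map φ = ends' e) {a b : V} {n : ℕ}
    (h : Reach ends l a b n) : Reach ends' l (φ a) (φ b) n := by
  refine induction (P := fun a b n => Reach ends' l (φ a) (φ b) n) (fun a => refl _) ?_ h
  intro a b c e n he _ ih
  exact cons (by rw [← hφ, he, Sym2.map_mk]) ih

/-- A walk is either empty or has a last edge. -/
theorem eq_or_last {a b : V} {n : ℕ} (h : Reach ends l a b n) :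
    (a = b ∧ n = 0) ∨
      ∃ c e m, Reach ends l a c m ∧ ends e = s(b, c) ∧ n = m + l e := by
  refine induction (P := fun a b n => (b = a ∧ n = 0) ∨
      ∃ c e m, Reach ends l b c m ∧ ends e = s(a, c) ∧ n = m + l e) ?_ ?_ h.symm |>.imp
      (fun h => h) (fun h => h)
  · intro a; exact Or.inl ⟨rfl, rfl⟩
  · intro a b c e n he hr _
    exact Or.inr ⟨b, e, n, hr.symm, he, add_comm _ _⟩

end Reach

section Classes

variable {E V : Type}

/-- The phase classes on the edges that have been reached from `S` by time `t`, where the edge `e`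
has endpoints `a e` and `b e`. -/
def reachedClasses (ends : E → Sym2 V) (l : E → ℕ) (a b : E → V) (S : Set V) (t : ℝ) :
    Set (Σ e, ZMod (2 * l e)) :=
  {c | ∃ v ∈ S, ∃ n : ℕ, (n : ℝ) ≤ t ∧
    ((Reach ends l v (a c.1) n ∧ c.2 = n) ∨ (Reach ends l v (b c.1) n ∧ c.2 = n + l c.1))}

variable {ends : E → Sym2 V} {l : E → ℕ} {a b : E → V} {S : Set V}

theorem reachedClasses_mono {t t' : ℝ} (h : t ≤ t') :
    reachedClasses ends l a b S t ⊆ reachedClasses ends l a b S t' := by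
  rintro c ⟨v, hv, n, hn, hc⟩
  exact ⟨v, hv, n, hn.trans h, hc⟩

theorem isPoint_iff {t s : ℝ} {e : E} {x : V} :
    IsPoint ends (fun e => (l e : ℝ)) S t e x s ↔
      x ∈ ends e ∧ 0 ≤ s ∧ s < l e ∧ ∃ v ∈ S, ∃ n : ℕ, Reach ends l v x n ∧ (n : ℝ) = t - s := by
  unfold IsPoint
  refine and_congr_right fun _ => and_congr_right fun _ => and_congr_right fun _ => ?_
  refine exists_congr fun v => and_congr_right fun _ => ⟨?_, ?_⟩
  · rintro ⟨w, hw⟩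
    obtain ⟨n, hn, h⟩ := Reach.of_walk (l := l) w
    exact ⟨n, hn, h.symm.trans hw⟩
  · rintro ⟨n, ⟨w, hw⟩, h⟩
    exact ⟨w, hw.trans h⟩

/-- Every reached class is represented by a dynamic point. -/
theorem exists_point_of_reach (hab : ∀ e, ends e = s(a e, b e))
    (e : E) (t : ℝ) {v : V} (hv : v ∈ S) (k n : ℕ) (hn : (n : ℝ) ≤ t) (hk : t - n < k * l e) :
    (Reach ends l v (a e) n → ∃ m : ℕ, ∃ x s, IsPoint ends (fun e => (l e : ℝ)) S t e x s ∧
      (m : ℝ) = t - s ∧ ((x = a e ∧ (m : ZMod (2 * l e)) = n) ∨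
        (x = b e ∧ (m + l e : ZMod (2 * l e)) = n))) ∧
    (Reach ends l v (b e) n → ∃ m : ℕ, ∃ x s, IsPoint ends (fun e => (l e : ℝ)) S t e x s ∧
      (m : ℝ) = t - s ∧ ((x = a e ∧ (m : ZMod (2 * l e)) = n + l e) ∨
        (x = b e ∧ (m + l e : ZMod (2 * l e)) = n + l e))) := by
  have h2 : (l e + l e : ZMod (2 * l e)) = 0 := by
    have := ZMod.natCast_self (2 * l e)
    push_cast at this
    rw [← two_mul]; exact this
  induction k generalizing n with
  | zero => exfalso; simp at hk; linarith
  | succ k ih =>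
    by_cases hlt : t - n < l e
    · refine ⟨fun hr => ⟨n, a e, t - n, isPoint_iff.2 ⟨by simp [hab], by linarith, hlt,
        v, hv, n, hr, by ring⟩, by ring, Or.inl ⟨rfl, rfl⟩⟩, fun hr => ⟨n, b e, t - n,
        isPoint_iff.2 ⟨by simp [hab], by linarith, hlt, v, hv, n, hr, by ring⟩, by ring,
        Or.inr ⟨rfl, rfl⟩⟩⟩
    · push_cast at hk
      have ih' := ih (n + l e) (by push_cast; linarith) (by push_cast; linarith)
      refine ⟨fun hr => ?_, fun hr => ?_⟩
      · have := ih'.2 (hr.trans (Reach.edge (hab e)))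
        push_cast at this
        rwa [add_assoc, h2, add_zero] at this
      · have := ih'.1 (hr.trans (Reach.edge ((hab e).trans Sym2.eq_swap)))
        push_cast at this
        exact this

theorem npts_eq (hl : ∀ e, 0 < l e) (hab : ∀ e, ends e = s(a e, b e)) (hne : ∀ e, a e ≠ b e)
    (t : ℝ) :
    Npts ends (fun e => (l e : ℝ)) S t = (reachedClasses ends l a b S t).ncard := by
  classical
  let F : E × V × ℝ → Σ e, ZMod (2 * l e) := fun p =>
    ⟨p.1, ((⌊t - p.2.2⌋₊ : ℕ) : ZMod (2 * l p.1)) + if p.2.1 = a p.1 then 0 else (l p.1 : ZMod _)⟩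
  have hF : F '' {p | IsPoint ends (fun e => (l e : ℝ)) S t p.1 p.2.1 p.2.2} =
      reachedClasses ends l a b S t := by
    ext ⟨e, θ⟩
    constructor
    · rintro ⟨⟨e', x, s⟩, hp, heq⟩
      obtain ⟨hx, hs0, hsl, v, hv, n, hr, hn⟩ := isPoint_iff.1 hp
      simp only [F, ← hn, Nat.floor_natCast] at heq
      rw [← heq]
      refine ⟨v, hv, n, by linarith, ?_⟩
      dsimp only at hx hr ⊢
      rw [hab, Sym2.mem_iff] at hx
      rcases hx with rfl | rfl
      · exact Or.inl ⟨hr, by simp⟩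
      · exact Or.inr ⟨hr, by simp [(hne _).symm]⟩
    · rintro ⟨v, hv, n, hn, hc⟩
      have hle : (0 : ℝ) < l e := by exact_mod_cast hl e
      obtain ⟨k, hk⟩ := exists_nat_gt ((t - n) / l e)
      rw [div_lt_iff₀ hle] at hk
      have key := exists_point_of_reach hab e t hv k n hn hk
      have : ∃ m : ℕ, ∃ x s, IsPoint ends (fun e => (l e : ℝ)) S t e x s ∧
          (m : ℝ) = t - s ∧ ((x = a e ∧ (m : ZMod (2 * l e)) = θ) ∨
          (x = b e ∧ (m + l e : ZMod (2 * l e)) = θ)) := by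
        rcases hc with ⟨hr, h⟩ | ⟨hr, h⟩
        · dsimp only at h; rw [h]; exact key.1 hr
        · dsimp only at h; rw [h]; exact key.2 hr
      obtain ⟨m, x, s, hp, hm, h⟩ := this
      refine ⟨(e, x, s), hp, ?_⟩
      simp only [F, ← hm, Nat.floor_natCast]
      rcases h with ⟨rfl, h⟩ | ⟨rfl, h⟩
      · simp [h]
      · simp [h, (hne _).symm]
  rw [← hF, Set.InjOn.ncard_image]
  · rfl
  rintro ⟨e, x, s⟩ hp ⟨e', x', s'⟩ hp' heq
  obtain ⟨hx, hs0, hsl, -, -, n, -, hn⟩ := isPoint_iff.1 hp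
  obtain ⟨hx', hs0', hsl', -, -, n', -, hn'⟩ := isPoint_iff.1 hp'
  simp only [F, ← hn, ← hn', Nat.floor_natCast, Sigma.mk.injEq] at heq
  obtain ⟨rfl, heq⟩ := heq
  have heq := eq_of_heq heq
  dsimp only at *
  have h1 : (n : ℤ) < n' + l e := by
    have : (n : ℝ) < n' + l e := by linarith
    exact_mod_cast this
  have h2 : (n' : ℤ) < n + l e := by
    have : (n' : ℝ) < n + l e := by linarith
    exact_mod_cast this
  have hsmall : ∀ z : ℤ, ((2 * l e : ℕ) : ℤ) ∣ z → |z| < 2 * l e → z = 0 := by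
    intro z hz hlt
    exact Int.eq_zero_of_abs_lt_dvd hz (by push_cast; exact hlt)
  rw [hab, Sym2.mem_iff] at hx hx'
  have conv : ∀ z : ℤ, ((z : ℤ) : ZMod (2 * l e)) = 0 → ((2 * l e : ℕ) : ℤ) ∣ z :=
    fun z hz => (ZMod.intCast_zmod_eq_zero_iff_dvd _ _).1 hz
  have hfin : (n : ℤ) - n' = 0 → x = x' → (e, x, s) = (e, x', s') := by
    intro h hxx
    have hnn : (n : ℝ) = n' := by
      have : n = n' := by omega
      rw [this]
    rw [hxx, show s = s' by linarith]
  rcases hx with rfl | rfl <;> rcases hx' with rfl | rfl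
  · refine hfin (hsmall _ (conv _ ?_) ?_) rfl
    · push_cast; simpa [sub_eq_zero] using heq
    · rw [abs_lt]; constructor <;> linarith
  · simp only [if_true, (hne _).symm, if_false, add_zero] at heq
    have := hsmall (n - (n' + l e)) (conv _ (by push_cast; rw [heq]; ring))
      (by rw [abs_lt]; constructor <;> linarith)
    omega
  · simp only [if_true, (hne _).symm, if_false, add_zero] at heq
    have := hsmall (n' - (n + l e)) (conv _ (by push_cast; rw [← heq]; ring))
      (by rw [abs_lt]; constructor <;> linarith)
    omega
  · refine hfin (hsmall _ (conv _ ?_) ?_) rfl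
    · push_cast; simpa [sub_eq_zero, (hne _).symm] using heq
    · rw [abs_lt]; constructor <;> linarith

theorem isStabBound_of_forall (hl : ∀ e, 0 < l e) (hab : ∀ e, ends e = s(a e, b e))
    (hne : ∀ e, a e ≠ b e) {T : ℝ} (hT : 0 ≤ T)
    (h : ∀ t, reachedClasses ends l a b S t ⊆ reachedClasses ends l a b S T) :
    IsStabBound ends (fun e => (l e : ℝ)) S T := by
  refine ⟨hT, fun t ht => ?_⟩
  rw [npts_eq hl hab hne, npts_eq hl hab hne, (h t).antisymm (reachedClasses_mono ht)]

theorem stabTime_nonneg (l : E → ℝ) : 0 ≤ stabTime ends l S :=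
  Real.sInf_nonneg fun _ h => h.1

variable [Finite E]

theorem finite_classes (hl : ∀ e, 0 < l e) : Finite (Σ e, ZMod (2 * l e)) := by
  have : ∀ e, NeZero (2 * l e) := fun e => ⟨by have := hl e; omega⟩
  infer_instance

theorem IsStabBound.mem_reachedClasses (hl : ∀ e, 0 < l e) (hab : ∀ e, ends e = s(a e, b e))
    (hne : ∀ e, a e ≠ b e) {T t : ℝ} (hT : IsStabBound ends (fun e => (l e : ℝ)) S T)
    {c : Σ e, ZMod (2 * l e)} (hc : c ∈ reachedClasses ends l a b S t) :
    c ∈ reachedClasses ends l a b S T := by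
  have := finite_classes hl
  rcases le_total t T with h | h
  · exact reachedClasses_mono h hc
  · have := hT.2 t h
    rw [npts_eq hl hab hne, npts_eq hl hab hne] at this
    rwa [Set.eq_of_subset_of_ncard_le (reachedClasses_mono h) this.le (Set.toFinite _)]

theorem exists_isStabBound_le (hl : ∀ e, 0 < l e) (hab : ∀ e, ends e = s(a e, b e))
    (hne : ∀ e, a e ≠ b e) (τ : (Σ e, ZMod (2 * l e)) → ℝ)
    (hτ : ∀ c t, c ∈ reachedClasses ends l a b S t → c ∈ reachedClasses ends l a b S (τ c)) :
    ∃ T, IsStabBound ends (fun e => (l e : ℝ)) S T ∧ (T = 0 ∨ ∃ c, T = τ c) := by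
  have := finite_classes hl
  obtain ⟨T, hTm, hT⟩ := Set.exists_max_image (insert 0 (Set.range τ)) id (Set.toFinite _)
    ⟨0, Set.mem_insert _ _⟩
  refine ⟨T, isStabBound_of_forall hl hab hne (hT 0 (Set.mem_insert _ _)) ?_, ?_⟩
  · intro t c hc
    exact reachedClasses_mono (hT (τ c) (Set.mem_insert_of_mem _ ⟨c, rfl⟩)) (hτ c t hc)
  · rcases hTm with h | ⟨c, h⟩
    · exact Or.inl h
    · exact Or.inr ⟨c, h.symm⟩

theorem exists_isStabBound (hl : ∀ e, 0 < l e) (hab : ∀ e, ends e = s(a e, b e))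
    (hne : ∀ e, a e ≠ b e) : ∃ T, IsStabBound ends (fun e => (l e : ℝ)) S T := by
  have : ∀ c, ∃ t', ∀ t, c ∈ reachedClasses ends l a b S t →
      c ∈ reachedClasses ends l a b S t' := by
    intro c
    by_cases h : ∃ t, c ∈ reachedClasses ends l a b S t
    · obtain ⟨t, ht⟩ := h
      exact ⟨t, fun _ _ => ht⟩
    · exact ⟨0, fun t ht => (h ⟨t, ht⟩).elim⟩
  choose τ hτ using this
  obtain ⟨T, hT, -⟩ := exists_isStabBound_le hl hab hne τ hτ
  exact ⟨T, hT⟩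

/-- A positive stabilization time is the first arrival time of some class. -/
theorem exists_class_of_stabTime_pos (hl : ∀ e, 0 < l e) (hab : ∀ e, ends e = s(a e, b e))
    (hne : ∀ e, a e ≠ b e) (hpos : 0 < stabTime ends (fun e => (l e : ℝ)) S) :
    ∃ c, (∃ t, c ∈ reachedClasses ends l a b S t) ∧
      ∀ t, c ∈ reachedClasses ends l a b S t → stabTime ends (fun e => (l e : ℝ)) S ≤ t := by
  by_contra! hcon
  have : ∀ c, ∃ t' < stabTime ends (fun e => (l e : ℝ)) S,
      ∀ t, c ∈ reachedClasses ends l a b S t → c ∈ reachedClasses ends l a b S t' := by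
    intro c
    by_cases h : ∃ t, c ∈ reachedClasses ends l a b S t
    · obtain ⟨t, ht, hlt⟩ := hcon c h
      exact ⟨t, hlt, fun _ _ => ht⟩
    · exact ⟨0, hpos, fun t ht => (h ⟨t, ht⟩).elim⟩
  choose τ hlt hτ using this
  obtain ⟨T, hT, h⟩ := exists_isStabBound_le hl hab hne τ hτ
  have hle : stabTime ends (fun e => (l e : ℝ)) S ≤ T := csInf_le ⟨0, fun _ h => h.1⟩ hT
  rcases h with rfl | ⟨c, rfl⟩
  · linarith
  · linarith [hlt c]

end Classes

section Bead

variable {E V : Type} [Finite E] {ends : E → Sym2 V}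

/-- If all edges but at most one form a rooted forest, then the graph is a bead graph. -/
theorem isBead_of_rank (F : Set E) (hF : Fᶜ.Subsingleton) (child parent : E → V) (rank : V → ℕ)
    (hends : ∀ e ∈ F, ends e = s(child e, parent e)) (hinj : Set.InjOn child F)
    (hrank : ∀ e ∈ F, rank (parent e) < rank (child e)) : IsBead ends := by
  have leaf : ∀ D ⊆ F, D.Nonempty → ∃ x, edgeDegree ends D x = 1 := by
    intro D hD hne
    obtain ⟨e, he, hmax⟩ := Set.exists_max_image D (fun e => rank (child e)) (Set.toFinite _) hne
    refine ⟨child e, Set.ncard_eq_one.2 ⟨e, ?_⟩⟩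
    ext e'
    simp only [Set.mem_ofPred_eq, Set.mem_singleton_iff]
    constructor
    · rintro ⟨he', hx⟩
      rw [hends e' (hD he'), Sym2.mem_iff] at hx
      rcases hx with hx | hx
      · exact (hinj (hD he) (hD he') hx).symm
      · have h1 := hrank e' (hD he')
        have h2 := hmax e' he'
        rw [← hx] at h1
        omega
    · rintro rfl
      exact ⟨he, by rw [hends _ (hD he)]; exact Sym2.mem_mk_left _ _⟩
  have even : ∀ C, IsCycleSet ends C → ∀ x, Even (edgeDegree ends C x) := by
    intro C hC x
    by_cases h : OnEdgeSet ends C x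
    · rw [hC.2.2 x h]; exact even_two
    · have : edgeDegree ends C x = 0 := by
        rw [edgeDegree, Set.ncard_eq_zero (Set.toFinite _)]
        ext e
        simp only [Set.mem_ofPred_eq, Set.mem_empty_iff_false, iff_false]
        exact fun he => h ⟨e, he⟩
      rw [this]; exact Even.zero
  have hnot : ∀ C, IsCycleSet ends C → ∃ f ∈ C, f ∉ F := by
    intro C hC
    by_contra! h
    obtain ⟨x, hx⟩ := leaf C h hC.1
    have := even C hC x
    rw [hx] at this
    exact absurd this (by decide)
  intro C₁ C₂ h₁ h₂ hne
  exfalso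
  obtain ⟨f, hf1, hfF⟩ := hnot C₁ h₁
  obtain ⟨f', hf2, hfF'⟩ := hnot C₂ h₂
  obtain rfl : f = f' := hF hfF hfF'
  have hsub : C₁ ∆ C₂ ⊆ F := by
    intro e he
    by_contra h
    obtain rfl : e = f := hF h hfF
    rw [Set.mem_symmDiff] at he
    tauto
  have hnem : (C₁ ∆ C₂).Nonempty := Set.symmDiff_nonempty.2 hne
  obtain ⟨x, hx⟩ := leaf _ hsub hnem
  have e1 := even C₁ h₁ x
  have e2 := even C₂ h₂ x
  unfold edgeDegree at hx e1 e2
  set A := {e ∈ C₁ | x ∈ ends e}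
  set B := {e ∈ C₂ | x ∈ ends e}
  have hAB : {e ∈ C₁ ∆ C₂ | x ∈ ends e} = (A \ B) ∪ (B \ A) := by
    ext e
    simp only [Set.mem_ofPred_eq, Set.mem_symmDiff, A, B, Set.mem_union, Set.mem_sdiff]
    tauto
  rw [hAB, Set.ncard_union_eq (by
    rw [Set.disjoint_left]; intro e h h'; exact h.2 h'.1) (Set.toFinite _) (Set.toFinite _)] at hx
  have h1 := Set.ncard_inter_add_ncard_sdiff_eq_ncard A B (Set.toFinite _)
  have h2 := Set.ncard_inter_add_ncard_sdiff_eq_ncard B A (Set.toFinite _)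
  rw [Set.inter_comm] at h2
  obtain ⟨r1, h3⟩ := e1
  obtain ⟨r2, h4⟩ := e2
  omega

end Bead

section Tree

variable {E V : Type} {ends : E → Sym2 V} {l : E → ℕ}

/-- A shortest-path tree from `v₀`. -/
theorem exists_shortest_path_tree (hl : ∀ e, 0 < l e)
    (hconn : ∀ a b : V, Nonempty (MGWalk ends a b)) (v₀ : V) :
    ∃ d : V → ℕ, d v₀ = 0 ∧ ∀ v, v ≠ v₀ →
      ∃ e u, ends e = s(v, u) ∧ d v = d u + l e ∧ d u < d v := by
  classical
  have hex : ∀ v, ∃ n, Reach ends l v₀ v n := fun v => by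
    obtain ⟨w⟩ := hconn v₀ v
    obtain ⟨n, hn, -⟩ := Reach.of_walk (l := l) w
    exact ⟨n, hn⟩
  refine ⟨fun v => Nat.find (hex v), ?_, ?_⟩
  · rw [Nat.find_eq_zero]; exact Reach.refl v₀
  · intro v hv
    rcases (Nat.find_spec (hex v)).eq_or_last with ⟨h, -⟩ | ⟨u, e, m, hr, he, hm⟩
    · exact absurd h.symm hv
    · have h1 : Nat.find (hex u) ≤ m := Nat.find_min' _ hr
      have h2 : Nat.find (hex v) ≤ Nat.find (hex u) + l e :=
        Nat.find_min' _ ((Nat.find_spec (hex u)).trans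
          (Reach.edge (he.trans Sym2.eq_swap)))
      have := hl e
      exact ⟨e, u, he, by dsimp only; omega, by dsimp only; omega⟩

/-- The second endpoint of `e` when only the edges in `K` keep it, and every other edge gets a new
leaf instead. -/
noncomputable def detachedEnd (b : E → V) (K : Set E) (e : E) : V ⊕ {e // e ∉ K} := by
  classical
  exact if h : e ∈ K then Sum.inl (b e) else Sum.inr ⟨e, h⟩

/-- The graph with edges `s(a e, b e)` where each edge outside `K` is made a pendant edge
at `a e`. -/
noncomputable def detach (a b : E → V) (K : Set E) (e : E) : Sym2 (V ⊕ {e // e ∉ K}) :=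
  s(Sum.inl (a e), detachedEnd b K e)

variable {a b : E → V} {K : Set E}

theorem detachedEnd_of_mem {e : E} (h : e ∈ K) : detachedEnd b K e = Sum.inl (b e) := by
  simp [detachedEnd, h]

theorem detachedEnd_of_notMem {e : E} (h : e ∉ K) : detachedEnd b K e = Sum.inr ⟨e, h⟩ := by
  simp [detachedEnd, h]

theorem elim_detachedEnd (e : E) :
    (detachedEnd b K e).elim id (fun f => b f.1) = b e := by
  by_cases h : e ∈ K
  · simp [detachedEnd_of_mem h]
  · simp [detachedEnd_of_notMem h]

theorem detach_of_mem (hab : ∀ e, ends e = s(a e, b e)) {e : E} (h : e ∈ K) :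
    detach a b K e = (ends e).map Sum.inl := by
  rw [detach, detachedEnd_of_mem h, hab, Sym2.map_mk]

theorem map_detach (hab : ∀ e, ends e = s(a e, b e)) (e : E) :
    (detach a b K e).map (Sum.elim id fun f => b f.1) = ends e := by
  rw [detach, Sym2.map_mk, elim_detachedEnd, hab]; rfl

/-- The residues modulo `M` of lengths of closed walks at `x`. -/
def closedWalkResidues (ends : E → Sym2 V) (l : E → ℕ) (M : ℕ) (hM : 0 < M) (x : V) :
    AddSubgroup ℤ where
  carrier := {z | ∃ k : ℕ, Reach ends l x x k ∧ (M : ℤ) ∣ k - z}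
  zero_mem' := ⟨0, Reach.refl x, by simp⟩
  add_mem' := by
    rintro y z ⟨k, hk, hky⟩ ⟨m, hm, hmz⟩
    refine ⟨k + m, hk.trans hm, ?_⟩
    have := dvd_add hky hmz
    push_cast
    rwa [show (k : ℤ) + m - (y + z) = k - y + (m - z) by ring]
  neg_mem' := by
    rintro z ⟨k, hk, hkz⟩
    have hmul : ∀ j : ℕ, Reach ends l x x (j * k) := by
      intro j
      induction j with
      | zero => simpa using Reach.refl x
      | succ j ih => rw [Nat.succ_mul]; exact ih.trans hk
    refine ⟨(M - 1) * k, hmul _, ?_⟩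
    rw [Nat.cast_mul, Nat.cast_pred hM]
    have := dvd_sub (dvd_mul_right (M : ℤ) k) hkz
    rwa [show ((M : ℤ) - 1) * k - -z = M * k - (k - z) by ring]

theorem closedWalkResidues_of_reach {M : ℕ} (hM : 0 < M) {x : V} {k : ℕ}
    (h : Reach ends l x x k) : (k : ℤ) ∈ closedWalkResidues ends l M hM x :=
  ⟨k, h, by simp⟩

theorem two_mul_mem_closedWalkResidues {M : ℕ} (hM : 0 < M) {x y z : V} {k : ℕ} {f : E}
    (h : Reach ends l x y k) (hf : ends f = s(y, z)) :
    2 * (l f : ℤ) ∈ closedWalkResidues ends l M hM x := by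
  have h1 := closedWalkResidues_of_reach hM (h.trans h.symm)
  have h2 := closedWalkResidues_of_reach hM
    ((h.trans ((Reach.edge hf).trans (Reach.edge (hf.trans Sym2.eq_swap)))).trans h.symm)
  have := sub_mem h2 h1
  push_cast at this
  rwa [show (k : ℤ) + (l f + l f) + k - (k + k) = 2 * l f by ring] at this

end Tree

section Construction

variable {E V : Type} {ends : E → Sym2 V} {l : E → ℕ} {a b : E → V}

theorem exists_gcd (l : E → ℕ) : ∃ g : ℤ, (∀ f, g ∣ l f) ∧
    ∀ C : AddSubgroup ℤ, (∀ f, 2 * (l f : ℤ) ∈ C) → 2 * g ∈ C := by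
  obtain ⟨g, hg⟩ := Int.subgroup_cyclic (AddSubgroup.closure (Set.range fun f => (l f : ℤ)))
  have hg' : ∀ z, z ∈ AddSubgroup.closure (Set.range fun f => (l f : ℤ)) ↔ g ∣ z := by
    intro z
    rw [hg, ← AddSubgroup.zmultiples_eq_closure, Int.mem_zmultiples_iff]
  refine ⟨g, fun f => (hg' _).1 (AddSubgroup.subset_closure ⟨f, rfl⟩), fun C hC => ?_⟩
  have hle : AddSubgroup.closure (Set.range fun f => (l f : ℤ)) ≤
      C.comap (AddMonoidHom.mulLeft 2) := by
    rw [AddSubgroup.closure_le]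
    rintro _ ⟨f, rfl⟩
    exact hC f
  exact hle ((hg' g).2 dvd_rfl)

theorem Reach.dvd {g : ℤ} (hg : ∀ f, g ∣ l f) {u v : V} {n : ℕ} (h : Reach ends l u v n) :
    g ∣ n := by
  refine Reach.induction (P := fun _ _ n => g ∣ (n : ℤ)) (fun _ => by simp) ?_ h
  intro _ _ _ e n _ _ ih
  push_cast
  exact dvd_add (hg e) ih

/-- Some graph obtained by detaching edges outside a spanning subgraph with at most one cycle still
realizes a given residue class of walk lengths. -/
theorem exists_detach [Finite E] [Finite V] (hl : ∀ e, 0 < l e)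
    (hab : ∀ e, ends e = s(a e, b e)) (hne : ∀ e, a e ≠ b e)
    (hconn : ∀ a b : V, Nonempty (MGWalk ends a b)) {v₀ x : V} {n M : ℕ} (hM : 0 < M)
    (hr : Reach ends l v₀ x n) :
    ∃ K : Set E, IsDPSystem (detach a b K) {Sum.inl v₀} ∧ IsBead (detach a b K) ∧
      ∃ n' : ℕ, Reach (detach a b K) l (Sum.inl v₀) (Sum.inl x) n' ∧ (M : ℤ) ∣ n' - n := by
  obtain ⟨d, hd0, hd⟩ := exists_shortest_path_tree hl hconn v₀
  choose p q hends hdl hlt using hd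
  obtain ⟨g, hgl, hgC⟩ := exists_gcd l
  set T : Set E := {e | ∃ v, ∃ hv : v ≠ v₀, p v hv = e}
  have tree : ∀ K, T ⊆ K → ∀ v, Reach (detach a b K) l (Sum.inl v₀) (Sum.inl v) (d v) := by
    intro K hK v
    induction hk : d v using Nat.strong_induction_on generalizing v with
    | _ k ih =>
      subst hk
      by_cases hv : v = v₀
      · subst hv; rw [hd0]; exact Reach.refl _
      · have h1 := ih _ (hlt v hv) (q v hv) rfl
        rw [hdl v hv]
        refine h1.trans (Reach.edge ?_)
        rw [detach_of_mem hab (hK ⟨v, hv, rfl⟩), hends, Sym2.map_mk]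
        exact Sym2.eq_swap
  have hdg : ∀ v, g ∣ d v := fun v => (tree T subset_rfl v).dvd hgl
  have main : ∀ X : Set E, X.Subsingleton →
      (∀ C : AddSubgroup ℤ, 2 * g ∈ C →
        (∀ f ∈ X, (d (a f) : ℤ) + d (b f) + l f ∈ C) → (n : ℤ) - d x ∈ C) →
      ∃ K : Set E, IsDPSystem (detach a b K) {Sum.inl v₀} ∧ IsBead (detach a b K) ∧
        ∃ n' : ℕ, Reach (detach a b K) l (Sum.inl v₀) (Sum.inl x) n' ∧ (M : ℤ) ∣ n' - n := by
    intro X hX hC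
    have hTK : T ⊆ T ∪ X := Set.subset_union_left
    have htree := tree (T ∪ X) hTK
    refine ⟨T ∪ X, ⟨inferInstance, ?_, ?_, Set.singleton_nonempty _⟩, ?_, ?_⟩
    · intro e
      rw [detach, Sym2.mk_isDiag_iff]
      by_cases h : e ∈ T ∪ X
      · rw [detachedEnd_of_mem h]
        exact fun h => hne e (Sum.inl_injective h)
      · rw [detachedEnd_of_notMem h]
        exact Sum.inl_ne_inr
    · have hall : ∀ y, ∃ k, Reach (detach a b (T ∪ X)) l (Sum.inl v₀) y k := by
        rintro (y | ⟨e, he⟩)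
        · exact ⟨_, htree y⟩
        · exact ⟨_, (htree (a e)).trans
            (Reach.edge (by rw [detach, detachedEnd_of_notMem he]))⟩
      intro y z
      obtain ⟨k, hk⟩ := hall y
      obtain ⟨m, hm⟩ := hall z
      exact ⟨(hk.symm.trans hm).choose⟩
    · have : ∀ e, ∃ c r : V ⊕ {e // e ∉ T ∪ X}, e ∈ Xᶜ →
          detach a b (T ∪ X) e = s(c, r) ∧
          Sum.elim d (fun f => d (a f.1) + 1) r < Sum.elim d (fun f => d (a f.1) + 1) c ∧
          ((∃ v, ∃ hv : v ≠ v₀, c = Sum.inl v ∧ p v hv = e) ∨ ∃ h, c = Sum.inr ⟨e, h⟩) := by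
        intro e
        by_cases he : e ∈ T
        · obtain ⟨v, hv, rfl⟩ := he
          refine ⟨Sum.inl v, Sum.inl (q v hv), fun _ => ⟨?_, hlt v hv, Or.inl ⟨v, hv, rfl, rfl⟩⟩⟩
          rw [detach_of_mem hab (hTK ⟨v, hv, rfl⟩), hends, Sym2.map_mk]
        · by_cases heX : e ∈ X
          · exact ⟨Sum.inl v₀, Sum.inl v₀, fun h => (h heX).elim⟩
          · have heK : e ∉ T ∪ X := by simp [he, heX]
            refine ⟨Sum.inr ⟨e, heK⟩, Sum.inl (a e), fun _ => ⟨?_, ?_, Or.inr ⟨heK, rfl⟩⟩⟩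
            · rw [detach, detachedEnd_of_notMem heK]
              exact Sym2.eq_swap
            · simp
      choose child parent hcp using this
      refine isBead_of_rank Xᶜ (by rwa [compl_compl]) child parent _ (fun e he => (hcp e he).1) ?_
        (fun e he => (hcp e he).2.1)
      intro e he e' he' heq
      rcases (hcp e he).2.2 with ⟨v, hv, hc, rfl⟩ | ⟨h, hc⟩ <;>
        rcases (hcp e' he').2.2 with ⟨v', hv', hc', rfl⟩ | ⟨h', hc'⟩
      · have : v = v' := Sum.inl_injective (hc.symm.trans (heq.trans hc'))
        subst this; rfl
      · exact (Sum.inl_ne_inr (hc.symm.trans (heq.trans hc'))).elim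
      · exact (Sum.inr_ne_inl (hc.symm.trans (heq.trans hc'))).elim
      · have := Sum.inr_injective (hc.symm.trans (heq.trans hc'))
        exact congrArg Subtype.val this
    · have h2 : 2 * g ∈ closedWalkResidues (detach a b (T ∪ X)) l M hM (Sum.inl x) := by
        refine hgC _ fun f => ?_
        exact two_mul_mem_closedWalkResidues hM ((htree x).symm.trans (htree (a f)))
          (f := f) rfl
      obtain ⟨k, hk, hdvd⟩ := hC (closedWalkResidues (detach a b (T ∪ X)) l M hM (Sum.inl x)) h2 (by
        intro f hf
        have he : detach a b (T ∪ X) f = s(Sum.inl (a f), Sum.inl (b f)) := by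
          rw [detach, detachedEnd_of_mem (Set.mem_union_right T hf)]
        have h1 := closedWalkResidues_of_reach hM ((htree x).symm.trans ((htree (a f)).trans
          ((Reach.edge he).trans ((htree (b f)).symm.trans (htree x)))))
        have h2 := closedWalkResidues_of_reach hM ((htree x).symm.trans (htree x))
        have h3 := sub_mem h1 h2
        push_cast at h3
        convert h3 using 1
        ring)
      refine ⟨d x + k, (htree x).trans hk, ?_⟩
      push_cast
      rwa [show (d x : ℤ) + k - n = k - (n - d x) by ring]
  have mem_of_dvd : ∀ (C : AddSubgroup ℤ) (y z : ℤ), y ∈ C → y ∣ z → z ∈ C := by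
    rintro C y _ hy ⟨k, rfl⟩
    rw [mul_comm, ← smul_eq_mul]
    exact C.zsmul_mem hy k
  by_cases hpar : ∀ f, 2 * g ∣ (d (a f) : ℤ) + d (b f) + l f
  · refine main ∅ Set.subsingleton_empty fun C h2 _ => mem_of_dvd C _ _ h2 ?_
    have hpot : ∀ u v f, ends f = s(u, v) → 2 * g ∣ (d u : ℤ) + d v + l f := by
      intro u v f hf
      rw [hab, Sym2.eq_iff] at hf
      rcases hf with ⟨rfl, rfl⟩ | ⟨rfl, rfl⟩
      · exact hpar f
      · rw [add_comm (d (b f) : ℤ)]; exact hpar f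
    have hwalk : ∀ {u v : V} {m : ℕ}, Reach ends l u v m → 2 * g ∣ (d u : ℤ) + m - d v := by
      intro u v m h
      refine Reach.induction (P := fun u v m => 2 * g ∣ (d u : ℤ) + m - d v) (by simp) ?_ h
      intro u w v f m hf _ ih
      have h1 := hpot u w f hf
      have h2 : 2 * g ∣ 2 * (d w : ℤ) := mul_dvd_mul_left 2 (hdg w)
      have := dvd_sub (dvd_add h1 ih) h2
      push_cast
      rwa [show (d u : ℤ) + (l f + m) - d v =
        d u + d w + l f + (d w + m - d v) - 2 * d w by ring]
    have := hwalk hr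
    rwa [hd0, Nat.cast_zero, zero_add] at this
  · push Not at hpar
    obtain ⟨f, hf⟩ := hpar
    refine main {f} Set.subsingleton_singleton fun C h2 hC => ?_
    have hfC := hC f rfl
    have hgC : g ∈ C := by
      obtain ⟨k, hk⟩ := dvd_add (dvd_add (hdg (a f)) (hdg (b f))) (hgl f)
      rw [hk] at hfC hf
      rcases Int.even_or_odd' k with ⟨j, rfl | rfl⟩
      · exact absurd ⟨j, by ring⟩ hf
      · have := sub_mem hfC (mem_of_dvd C _ _ h2 (dvd_mul_right (2 * g) j))
        rwa [show g * (2 * j + 1) - 2 * g * j = g by ring] at this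
    exact mem_of_dvd C _ _ hgC (dvd_sub (hr.dvd hgl) (hdg x))

theorem exists_star [Finite E] :
    ∃ (V : Type) (ends : E → Sym2 V) (v₀ : V), IsDPSystem ends {v₀} ∧ IsBead ends := by
  refine ⟨Option E, fun e => s(some e, none), none,
    ⟨inferInstance, fun e => by simp, ?_, Set.singleton_nonempty _⟩, ?_⟩
  · have hto : ∀ y : Option E, Reach (fun e : E => s(some e, none)) (fun _ => 0) y none 0 := by
      rintro (_ | e)
      · exact Reach.refl _
      · exact Reach.edge (l := fun _ => 0) (e := e) rfl
    intro y z
    exact ⟨((hto y).trans (hto z).symm).choose⟩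
  · exact isBead_of_rank Set.univ (by simp) some (fun _ => none) (fun y => y.elim 0 fun _ => 1)
      (fun _ _ => rfl) (Option.some_injective E).injOn (fun _ _ => by simp)

theorem exists_bead_stabTime_le [Finite E] {S : Set V} (hl : ∀ e, 0 < l e)
    (h : IsDPSystem ends S) :
    ∃ (V' : Type) (ends' : E → Sym2 V') (v₀ : V'), IsDPSystem ends' {v₀} ∧ IsBead ends' ∧
      stabTime ends (fun e => (l e : ℝ)) S ≤ stabTime ends' (fun e => (l e : ℝ)) {v₀} := by
  by_cases hpos : 0 < stabTime ends (fun e => (l e : ℝ)) S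
  swap
  · obtain ⟨V', ends', v₀, h1, h2⟩ := exists_star (E := E)
    exact ⟨V', ends', v₀, h1, h2, (not_lt.1 hpos).trans (stabTime_nonneg _)⟩
  obtain ⟨hV, hdiag, hconn, -⟩ := h
  have : ∀ e, ∃ x y, ends e = s(x, y) := fun e => by
    induction ends e with
    | _ x y => exact ⟨x, y, rfl⟩
  choose a b hab using this
  have hne : ∀ e, a e ≠ b e := fun e => by
    have := hdiag e
    rwa [hab, Sym2.mk_isDiag_iff] at this
  obtain ⟨⟨e, θ⟩, ⟨t, v₀, hv₀, m, -, hc⟩, hmin⟩ := exists_class_of_stabTime_pos hl hab hne hpos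
  have hreach : ∃ n, Reach ends l v₀ (a e) n ∧ θ = n := by
    rcases hc with ⟨hr, hθ⟩ | ⟨hr, hθ⟩
    · exact ⟨m, hr, hθ⟩
    · refine ⟨m + l e, hr.trans (Reach.edge ((hab e).trans Sym2.eq_swap)), ?_⟩
      push_cast
      exact hθ
  obtain ⟨n, hr, hθ⟩ := hreach
  obtain ⟨K, hDP, hbead, n', hr', hdvd⟩ :=
    exists_detach (M := 2 * l e) hl hab hne hconn (by have := hl e; omega) hr
  refine ⟨_, detach a b K, Sum.inl v₀, hDP, hbead, ?_⟩
  have hab' : ∀ e, detach a b K e = s(Sum.inl (a e), detachedEnd b K e) := fun _ => rfl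
  have hne' : ∀ e, Sum.inl (a e) ≠ detachedEnd b K e := fun e => by
    have := hDP.2.1 e
    rwa [hab', Sym2.mk_isDiag_iff] at this
  have hmem : ⟨e, θ⟩ ∈ reachedClasses (detach a b K) l (fun e => Sum.inl (a e)) (detachedEnd b K)
      {Sum.inl v₀} n' := by
    refine ⟨_, rfl, n', le_rfl, Or.inl ⟨hr', ?_⟩⟩
    rw [hθ]
    have := (ZMod.intCast_eq_intCast_iff_dvd_sub (n : ℤ) (n' : ℤ) (2 * l e)).2 hdvd
    exact_mod_cast this
  refine le_csInf (exists_isStabBound hl hab' hne') fun T hT => hmin T ?_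
  obtain ⟨_, rfl, k, hk, hc⟩ := IsStabBound.mem_reachedClasses hl hab' hne' hT hmem
  refine ⟨v₀, hv₀, k, hk, hc.imp (And.imp_left fun h => ?_) (And.imp_left fun h => ?_)⟩
  · exact h.map (map_detach hab)
  · have := h.map (map_detach hab)
    rwa [show Sum.elim id (fun f : {e // e ∉ K} => b f.1) (detachedEnd b K e) = b e from
      elim_detachedEnd e] at this

end Construction

section Maximum

variable {E V V' : Type} {ends : E → Sym2 V} {ends' : E → Sym2 V'} {l : E → ℕ}

theorem IsPoint.map {S : Set V} {t s : ℝ} {e : E} {x : V} {φ : V → V'}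
    (hφ : ∀ e, (ends e).map φ = ends' e) (h : IsPoint ends (fun e => (l e : ℝ)) S t e x s) :
    IsPoint ends' (fun e => (l e : ℝ)) (φ '' S) t e (φ x) s := by
  rw [isPoint_iff] at h ⊢
  obtain ⟨hx, h0, hs, v, hv, n, hr, hn⟩ := h
  exact ⟨by rw [← hφ]; exact Sym2.mem_map.2 ⟨x, hx, rfl⟩, h0, hs, φ v, ⟨v, hv, rfl⟩, n,
    hr.map hφ, hn⟩

theorem stabTime_map (φ : V ≃ V') (S : Set V) :
    stabTime (fun e => (ends e).map φ) (fun e => (l e : ℝ)) (φ '' S) =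
      stabTime ends (fun e => (l e : ℝ)) S := by
  have hN : ∀ t, Npts (fun e => (ends e).map φ) (fun e => (l e : ℝ)) (φ '' S) t =
      Npts ends (fun e => (l e : ℝ)) S t := by
    intro t
    have hinj : Function.Injective fun p : E × V × ℝ => (p.1, φ p.2.1, p.2.2) := by
      rintro ⟨e, x, s⟩ ⟨e', x', s'⟩ h
      simpa using h
    unfold Npts
    rw [← Set.ncard_image_of_injective _ hinj]
    congr 1
    ext ⟨e, y, s⟩
    constructor
    · intro h
      refine ⟨(e, φ.symm y, s), ?_, by simp⟩
      have h' : IsPoint (fun e => (ends e).map φ) (fun e => (l e : ℝ)) (φ '' S) t e y s := h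
      have := h'.map (ends' := ends) (φ := φ.symm) (fun e => by simp [Sym2.map_map])
      simpa using this
    · rintro ⟨⟨e', x, s'⟩, h, heq⟩
      obtain ⟨rfl, rfl, rfl⟩ : e' = e ∧ φ x = y ∧ s' = s := by simpa using heq
      exact IsPoint.map (fun _ => rfl) h
  unfold stabTime IsStabBound
  simp only [hN]

theorem IsDPSystem.map {S : Set V} (h : IsDPSystem ends S) (φ : V ≃ V') :
    IsDPSystem (fun e => (ends e).map φ) (φ '' S) := by
  obtain ⟨hV, hdiag, hconn, hS⟩ := h
  refine ⟨Finite.of_equiv V φ, fun e he => hdiag e ?_, fun x y => ?_, hS.image φ⟩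
  · exact (Sym2.isDiag_map φ.injective).1 he
  · obtain ⟨w⟩ := hconn (φ.symm x) (φ.symm y)
    obtain ⟨n, hn, -⟩ := Reach.of_walk (l := fun _ => 0) w
    have := hn.map (φ := φ) (ends' := fun e => (ends e).map φ) (fun _ => rfl)
    rw [φ.apply_symm_apply, φ.apply_symm_apply] at this
    exact ⟨this.choose⟩

theorem IsDPSystem.card_le [Finite E] {S : Set V} (h : IsDPSystem ends S) :
    Nat.card V ≤ Nat.card (Option (E × Bool)) := by
  obtain ⟨hV, hdiag, hconn, v₀, -⟩ := h
  have : ∀ e, ∃ x y, ends e = s(x, y) := fun e => by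
    induction ends e with
    | _ x y => exact ⟨x, y, rfl⟩
  choose a b hab using this
  refine Nat.card_le_card_of_surjective
    (fun o : Option (E × Bool) => o.elim v₀ fun p => if p.2 then a p.1 else b p.1) fun v => ?_
  obtain ⟨w⟩ := hconn v₀ v
  obtain ⟨n, hn, -⟩ := Reach.of_walk (l := fun _ => 0) w
  rcases hn.eq_or_last with ⟨h, -⟩ | ⟨c, e, m, -, he, -⟩
  · exact ⟨none, h⟩
  · rw [hab, Sym2.eq_iff] at he
    rcases he with ⟨h, -⟩ | ⟨-, h⟩
    · exact ⟨some (e, true), by simpa using h⟩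
    · exact ⟨some (e, false), by simpa using h⟩

/-- The maximal stabilization time is attained. -/
theorem exists_isMaxStab [Finite E] (l : E → ℕ) :
    ∃ (V : Type) (ends : E → Sym2 V) (S : Set V),
      IsDPSystem ends S ∧ IsMaxStab (fun e => (l e : ℝ)) ends S := by
  let I := Σ n : Fin (Nat.card (Option (E × Bool)) + 1), (E → Sym2 (Fin n)) × Set (Fin n)
  have normal : ∀ (V : Type) (ends : E → Sym2 V) (S : Set V), IsDPSystem ends S →
      ∃ i : I, IsDPSystem i.2.1 i.2.2 ∧ stabTime i.2.1 (fun e => (l e : ℝ)) i.2.2 =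
        stabTime ends (fun e => (l e : ℝ)) S := by
    intro V ends S h
    have := h.1
    let φ := Finite.equivFin V
    exact ⟨⟨⟨Nat.card V, Nat.lt_succ_of_le h.card_le⟩, fun e => (ends e).map φ, φ '' S⟩,
      h.map φ, stabTime_map φ S⟩
  obtain ⟨V, ends, v₀, h, -⟩ := exists_star (E := E)
  obtain ⟨i₀, hi₀, -⟩ := normal V ends _ h
  have hfin : Finite I := inferInstance
  obtain ⟨i, hi, hmax⟩ := Set.exists_max_image {i : I | IsDPSystem i.2.1 i.2.2}
    (fun i => stabTime i.2.1 (fun e => (l e : ℝ)) i.2.2) (Set.toFinite _) ⟨i₀, hi₀⟩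
  refine ⟨_, i.2.1, i.2.2, hi, fun V' ends' S' h' => ?_⟩
  obtain ⟨j, hj, hjeq⟩ := normal V' ends' S' h'
  rw [← hjeq]
  exact hmax j hj

end Maximum

/-- `LSTDP(E)` contains a DP-system on a bead graph with a single
initial vertex. -/
theorem stmt2 {E : Type} [Fintype E] (l : E → ℕ) (hl : ∀ e, 0 < l e) :
    ∃ (V : Type) (ends : E → Sym2 V) (v₀ : V),
      IsDPSystem ends {v₀} ∧
      IsBead ends ∧
      IsMaxStab (fun e => (l e : ℝ)) ends {v₀} := by
  obtain ⟨V, ends, S, hDP, hmax⟩ := exists_isMaxStab l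
  obtain ⟨V', ends', v₀, hDP', hbead, hle⟩ := exists_bead_stabTime_le hl hDP
  exact ⟨V', ends', v₀, hDP', hbead, fun W e T h => (hmax W e T h).trans hle⟩
end
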